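/- Let T > 0. Then there exists a positive constant C_T > 0 such that for all Schwartz functions u ∈ 𝒮(ℝ^{2n+1}_{t,x,v}) satisfying supp u(·,x,v) ⊂ [−T,T] for every (x,v) ∈ ℝ^{2n}, one has ‖(1 + |D_x|^{2σ/(2σ+1)} + |D_v|^{2σ}) u‖_{L²(ℝ^{2n+1})} ≤ C_T (‖Pu‖_{L²(ℝ^{2n+1})} + ‖u‖_{L²(ℝ^{2n+1})}). -/

import Mathlib

open MeasureTheory
open scoped ENNReal Real

noncomputable section

/-- `ℝ^n` with the Euclidean norm. -/
abbrev E (n : ℕ) : Type := EuclideanSpace ℝ (Fin n)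
/-- `ℝ^{2n+1} = ℝ_t × ℝ^n_x × ℝ^n_v` with the Euclidean norm. -/
abbrev Z (n : ℕ) : Type := EuclideanSpace ℝ (Unit ⊕ Fin n ⊕ Fin n)

variable {n : ℕ}

/-- the `t` (resp. dual `τ`) coordinate -/
def tC (ζ : Z n) : ℝ := ζ (Sum.inl ())
/-- the `x` (resp. dual `ξ`) coordinates -/
def xC (ζ : Z n) : E n := WithLp.toLp 2 fun i => ζ (Sum.inr (Sum.inl i))
/-- the `v` (resp. dual `η`) coordinates -/
def vC (ζ : Z n) : E n := WithLp.toLp 2 fun i => ζ (Sum.inr (Sum.inr i))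

/-- the unit vector in the `t` direction -/
def eT : Z n := EuclideanSpace.single (Sum.inl ()) 1
/-- the unit vector in the `xᵢ` direction -/
def eX (i : Fin n) : Z n := EuclideanSpace.single (Sum.inr (Sum.inl i)) 1

/-- the symbol `F(η) = |η|^{2σ} w(η) + |η|² (1 - w(η))` -/
def Fsym (σ : ℝ) (w : E n → ℝ) (η : E n) : ℝ :=
  ‖η‖ ^ (2 * σ) * w η + ‖η‖ ^ 2 * (1 - w η)

/-- the fractional Laplacian `(-Δ̃_v)^σ`, the Fourier multiplier with symbol `F(η)` -/
def fracLap (σ : ℝ) (w : E n → ℝ) (u : Z n → ℂ) : Z n → ℂ :=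
  FourierTransformInv.fourierInv (fun ζ => (Fsym σ w (vC ζ) : ℂ) * FourierTransform.fourier u ζ)

/-- the kinetic operator `P = ∂_t + v⋅∂_x + a(t,x,v) (-Δ̃_v)^σ` -/
def Pop (σ : ℝ) (w : E n → ℝ) (a : Z n → ℝ) (u : Z n → ℂ) (z : Z n) : ℂ :=
  fderiv ℝ u z eT + ∑ i : Fin n, (vC z i : ℂ) * fderiv ℝ u z (eX i)
    + (a z : ℂ) * fracLap σ w u z


open FourierTransform SchwartzMap ComplexConjugate

set_option linter.unusedSectionVars false
set_option linter.unusedVariables false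

section General

variable {V : Type*} [NormedAddCommGroup V] [InnerProductSpace ℝ V] [FiniteDimensional ℝ V]
  [MeasurableSpace V] [BorelSpace V]

/-- the Hilbert space `L²` -/
abbrev HH (V : Type*) [NormedAddCommGroup V] [InnerProductSpace ℝ V] [FiniteDimensional ℝ V]
  [MeasurableSpace V] [BorelSpace V] : Type _ := Lp (α := V) ℂ 2 volume

lemma continuous_fourierInv_of_integrable {g : V → ℂ} (h1 : Integrable g) :
    Continuous (𝓕⁻ g) := by
  have : Continuous (𝓕 g) :=
    VectorFourier.fourierIntegral_continuous Real.continuous_fourierChar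
      (by exact continuous_inner) h1
  have h2 : 𝓕⁻ g = fun w => 𝓕 g (-w) := by
    ext w; exact Real.fourierInv_eq_fourier_neg g w
  rw [h2]
  exact this.comp continuous_neg

lemma integral_mul_fourierInv {g : V → ℂ} (h1 : Integrable g) (φ : 𝓢(V, ℂ)) :
    ∫ x, φ x * (𝓕⁻ g) x = ∫ x, (𝓕⁻ φ) x * g x := by
  have e1 : 𝓕⁻ g = 𝓕 (fun x => g (-x)) := Real.fourierInv_eq_fourier_comp_neg g
  have h1' : Integrable (fun x => g (-x)) := h1.comp_neg
  have := VectorFourier.integral_bilin_fourierIntegral_eq_flip (ContinuousLinearMap.mul ℂ ℂ)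
    (L := innerₗ V) (μ := volume) (ν := volume)
    Real.continuous_fourierChar continuous_inner φ.integrable h1'
  have h2 : ∫ x, (𝓕 (φ : V → ℂ)) x * g (-x) = ∫ x, φ x * 𝓕 (fun x => g (-x)) x := by
    simpa using! this
  rw [e1, ← h2, ← integral_neg_eq_self]
  congr 1
  ext x
  rw [SchwartzMap.fourierInv_coe, Real.fourierInv_eq_fourier_neg]
  simp

lemma fourierInv_toLp_ae {g : V → ℂ} (h1 : Integrable g) (h2 : MemLp g 2 volume) :
    ((𝓕⁻ (h2.toLp g) : HH V) : V → ℂ) =ᵐ[volume] 𝓕⁻ g := by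
  apply ae_eq_of_integral_contDiff_smul_eq
  · exact (Lp.memLp _).locallyIntegrable (by norm_num)
  · exact (continuous_fourierInv_of_integrable h1).locallyIntegrable
  · intro φ hφ hc
    have hφ' : ContDiff ℝ (⊤ : ℕ∞) (fun x => (φ x : ℂ)) :=
      Complex.ofRealCLM.contDiff.comp hφ
    have hc' : HasCompactSupport (fun x => (φ x : ℂ)) :=
      hc.comp_left (g := fun r : ℝ => (r : ℂ)) (by simp)
    let ψ : 𝓢(V, ℂ) := hc'.toSchwartzMap hφ'
    have hψ : ∀ x, ψ x = (φ x : ℂ) := fun x => rfl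
    have e1 := integral_mul_fourierInv h1 ψ
    have e2 := congrArg (fun D => D ψ) (Lp.fourierInv_toTemperedDistribution_eq (h2.toLp g))
    simp only [TemperedDistribution.fourierInv_apply, Lp.toTemperedDistribution_apply,
      smul_eq_mul] at e2
    have e3 : ∫ x, (𝓕⁻ ψ) x * (h2.toLp g) x = ∫ x, (𝓕⁻ ψ) x * g x := by
      apply integral_congr_ae
      filter_upwards [h2.coeFn_toLp] with x hx
      rw [hx]
    simp only [Complex.real_smul]
    simp only [hψ] at e1 e2
    rw [e1, ← e3, e2]

/-- polynomially bounded measurable symbols -/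
def Adm (m : V → ℂ) : Prop :=
  Measurable m ∧ ∃ (C : ℝ) (k : ℕ), ∀ z, ‖m z‖ ≤ C * (1 + ‖z‖) ^ k

lemma Adm.pos {m : V → ℂ} (h : Adm m) : ∃ (C : ℝ) (k : ℕ), 0 ≤ C ∧ ∀ z, ‖m z‖ ≤ C * (1 + ‖z‖) ^ k := by
  obtain ⟨_, C, k, h⟩ := h
  refine ⟨|C|, k, abs_nonneg _, fun z => (h z).trans ?_⟩
  gcongr
  exact le_abs_self _

lemma Adm.mul {m m' : V → ℂ} (h : Adm m) (h' : Adm m') : Adm (fun z => m z * m' z) := by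
  obtain ⟨C, k, hC, hk⟩ := h.pos
  obtain ⟨C', k', hC', hk'⟩ := h'.pos
  refine ⟨h.1.mul h'.1, C * C', k + k', fun z => ?_⟩
  rw [norm_mul]
  calc _ ≤ (C * (1 + ‖z‖) ^ k) * (C' * (1 + ‖z‖) ^ k') := by
        gcongr
        · exact hk z
        · exact hk' z
    _ = _ := by ring

lemma Adm.add {m m' : V → ℂ} (h : Adm m) (h' : Adm m') : Adm (fun z => m z + m' z) := by
  obtain ⟨C, k, hC, hk⟩ := h.pos
  obtain ⟨C', k', hC', hk'⟩ := h'.pos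
  refine ⟨h.1.add h'.1, C + C', k + k', fun z => ?_⟩
  have h1 : (1 : ℝ) ≤ 1 + ‖z‖ := by simp
  calc _ ≤ ‖m z‖ + ‖m' z‖ := norm_add_le _ _
    _ ≤ (C * (1 + ‖z‖) ^ k) + (C' * (1 + ‖z‖) ^ k') := add_le_add (hk z) (hk' z)
    _ ≤ (C * (1 + ‖z‖) ^ (k + k')) + (C' * (1 + ‖z‖) ^ (k + k')) := by
        gcongr <;> first | exact h1 | omega
    _ = _ := by ring

lemma Adm.of_bdd {m : V → ℂ} (hm : Measurable m) (C : ℝ) (h : ∀ z, ‖m z‖ ≤ C) : Adm m :=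
  ⟨hm, C, 0, by simpa using h⟩

lemma Adm.of_le {m : V → ℂ} {m' : V → ℂ} (hm : Measurable m) (h' : Adm m')
    (h : ∀ z, ‖m z‖ ≤ ‖m' z‖) : Adm m := by
  obtain ⟨C, k, hC, hk⟩ := h'.pos
  exact ⟨hm, C, k, fun z => (h z).trans (hk z)⟩

lemma Adm.const (c : ℂ) : Adm (fun _ : V => c) := Adm.of_bdd measurable_const ‖c‖ (by simp)

lemma Adm.smul {m : V → ℂ} (c : ℂ) (h : Adm m) : Adm (fun z => c * m z) := (Adm.const c).mul h

lemma Adm.sub {m m' : V → ℂ} (h : Adm m) (h' : Adm m') : Adm (fun z => m z - m' z) := by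
  have := h.add (h'.smul (-1))
  simpa [sub_eq_add_neg] using this

lemma Adm.bound {m : V → ℂ} (hm : Adm m) (f : 𝓢(V, ℂ)) (d : ℕ) :
    ∃ C, ∀ z, ‖m z * f z‖ ≤ C * ((1 + ‖z‖) ^ d)⁻¹ := by
  obtain ⟨C, k, hC, hk⟩ := hm.pos
  refine ⟨C * (2 ^ (k + d) * ((Finset.Iic (k + d, 0)).sup fun m => SchwartzMap.seminorm ℝ m.1 m.2) f),
    fun z => ?_⟩
  have := SchwartzMap.one_add_le_sup_seminorm_apply (𝕜 := ℝ) (m := (k + d, 0)) (k := k + d) (n := 0)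
    le_rfl le_rfl f z
  simp only [norm_iteratedFDeriv_zero] at this
  have hp : 0 < (1 + ‖z‖) ^ d := by positivity
  rw [← div_eq_mul_inv, le_div_iff₀ hp, norm_mul]
  calc _ ≤ (C * (1 + ‖z‖) ^ k) * ‖f z‖ * (1 + ‖z‖) ^ d := by gcongr; exact hk z
    _ = C * ((1 + ‖z‖) ^ (k + d) * ‖f z‖) := by ring
    _ ≤ _ := by gcongr

lemma Adm.integrable {m : V → ℂ} (hm : Adm m) (f : 𝓢(V, ℂ)) :
    Integrable (fun z => m z * f z) := by
  obtain ⟨C, hC⟩ := hm.bound f (Module.finrank ℝ V + 1)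
  have h1 : Integrable (fun z : V => (1 + ‖z‖) ^ (-((Module.finrank ℝ V + 1 : ℕ) : ℝ))) :=
    integrable_one_add_norm (by push_cast; linarith)
  refine (h1.const_mul C).mono' ?_ (Filter.Eventually.of_forall fun z => ?_)
  · exact (hm.1.mul f.continuous.measurable).aestronglyMeasurable
  · refine (hC z).trans (le_of_eq ?_)
    rw [Real.rpow_neg (by positivity), Real.rpow_natCast]

lemma Adm.memLp {m : V → ℂ} (hm : Adm m) (f : 𝓢(V, ℂ)) :
    MemLp (fun z => m z * f z) 2 volume := by
  obtain ⟨C, hC⟩ := hm.bound f 0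
  have hi := hm.integrable f
  rw [memLp_two_iff_integrable_sq_norm hi.1]
  refine (hi.norm.const_mul C).mono' (hi.1.norm.pow 2) (Filter.Eventually.of_forall fun z => ?_)
  rw [Real.norm_of_nonneg (by positivity), pow_two]
  gcongr
  simpa using hC z

open Classical in
/-- `Sm f m` is the `L²` element whose Fourier transform is `m * f`. -/
def Sm (f : 𝓢(V, ℂ)) (m : V → ℂ) : HH V :=
  if h : MemLp (fun z => m z * f z) 2 volume then 𝓕⁻ (h.toLp _) else 0

lemma Sm_eq {f : 𝓢(V, ℂ)} {m : V → ℂ} (hm : Adm m) :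
    Sm f m = 𝓕⁻ ((hm.memLp f).toLp _) := by
  simp [Sm, hm.memLp f]

lemma fourier_Sm {f : 𝓢(V, ℂ)} {m : V → ℂ} (hm : Adm m) :
    𝓕 (Sm f m) = (hm.memLp f).toLp _ := by
  rw [Sm_eq hm, FourierTransform.fourier_fourierInv_eq]

lemma Sm_ae {f : 𝓢(V, ℂ)} {m : V → ℂ} (hm : Adm m) :
    (Sm f m : V → ℂ) =ᵐ[volume] 𝓕⁻ (fun z => m z * f z) := by
  rw [Sm_eq hm]
  exact fourierInv_toLp_ae (hm.integrable f) (hm.memLp f)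

lemma inner_Sm {f : 𝓢(V, ℂ)} {m : V → ℂ} (hm : Adm m) (W : HH V) :
    inner ℂ W (Sm f m) = ∫ z, (m z * f z) * conj ((𝓕 W : HH V) z) := by
  rw [← Lp.inner_fourier_eq, fourier_Sm hm, L2.inner_def]
  apply integral_congr_ae
  filter_upwards [(hm.memLp f).coeFn_toLp] with z hz
  rw [hz]; rfl

lemma integrable_Sm {f : 𝓢(V, ℂ)} {m : V → ℂ} (hm : Adm m) (W : HH V) :
    Integrable (fun z => (m z * f z) * conj ((W : HH V) z)) := by
  have := MemLp.integrable_mul (p := 2) (q := 2) (hm.memLp f) (Lp.memLp W).star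
  exact this

lemma inner_Sm_Sm {f : 𝓢(V, ℂ)} {m m' : V → ℂ} (hm : Adm m) (hm' : Adm m') :
    inner ℂ (Sm f m') (Sm f m) = ∫ z, (m z * f z) * conj (m' z * f z) := by
  rw [inner_Sm hm, fourier_Sm hm']
  apply integral_congr_ae
  filter_upwards [(hm'.memLp f).coeFn_toLp] with z hz
  rw [hz]

lemma norm_Sm_sq {f : 𝓢(V, ℂ)} {m : V → ℂ} (hm : Adm m) :
    ‖Sm f m‖ ^ 2 = ∫ z, ‖m z * f z‖ ^ 2 := by
  have h := inner_Sm_Sm (f := f) hm hm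
  rw [inner_self_eq_norm_sq_to_K] at h
  have h2 : ∫ z, (m z * f z) * conj (m z * f z) = ((∫ z, ‖m z * f z‖ ^ 2 : ℝ) : ℂ) := by
    rw [← integral_complex_ofReal]
    congr 1; ext z
    rw [Complex.mul_conj, Complex.normSq_eq_norm_sq]
  rw [h2] at h
  have h3 : ((‖Sm f m‖ ^ 2 : ℝ) : ℂ) = ((∫ z, ‖m z * f z‖ ^ 2 : ℝ) : ℂ) := by
    rw [← h]; push_cast; rfl
  exact Complex.ofReal_injective h3

lemma Adm.integrable_sq {m : V → ℂ} (hm : Adm m) (f : 𝓢(V, ℂ)) :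
    Integrable (fun z => ‖m z * f z‖ ^ 2) :=
  (memLp_two_iff_integrable_sq_norm (hm.memLp f).1).1 (hm.memLp f)

lemma norm_Sm_le {f : 𝓢(V, ℂ)} {m m' : V → ℂ} (hm : Adm m) (hm' : Adm m') {c : ℝ} (hc : 0 ≤ c)
    (h : ∀ z, ‖m z‖ ≤ c * ‖m' z‖) : ‖Sm f m‖ ≤ c * ‖Sm f m'‖ := by
  apply le_of_sq_le_sq _ (by positivity)
  rw [mul_pow, norm_Sm_sq hm, norm_Sm_sq hm', ← integral_const_mul]
  apply integral_mono (hm.integrable_sq f) ((hm'.integrable_sq f).const_mul _)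
  intro z
  simp only [norm_mul, mul_pow, ← mul_assoc]
  gcongr
  rw [← mul_pow]
  gcongr
  exact h z

lemma Sm_add {f : 𝓢(V, ℂ)} {m m' : V → ℂ} (hm : Adm m) (hm' : Adm m') :
    Sm f (fun z => m z + m' z) = Sm f m + Sm f m' := by
  rw [Sm_eq (hm.add hm'), Sm_eq hm, Sm_eq hm', ← FourierTransform.fourierInv_add,
    ← MemLp.toLp_add]
  congr 2
  ext z
  simp [add_mul]

lemma Sm_smul {f : 𝓢(V, ℂ)} {m : V → ℂ} (c : ℂ) (hm : Adm m) :
    Sm f (fun z => c * m z) = c • Sm f m := by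
  rw [Sm_eq (hm.smul c), Sm_eq hm, ← FourierTransform.fourierInv_smul,
    ← MemLp.toLp_const_smul]
  congr 2
  ext z
  simp [mul_assoc]

lemma Sm_sub {f : 𝓢(V, ℂ)} {m m' : V → ℂ} (hm : Adm m) (hm' : Adm m') :
    Sm f (fun z => m z - m' z) = Sm f m - Sm f m' := by
  have := Sm_add (f := f) hm (hm'.smul (-1))
  rw [Sm_smul _ hm'] at this
  simpa [sub_eq_add_neg] using this

/-- translation by `h` -/
def shf (h : V) : HH V →ₗᵢ[ℂ] HH V :=
  Lp.compMeasurePreservingₗᵢ ℂ (fun z => z + h) (measurePreserving_add_right volume h)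

lemma shf_ae (h : V) (W : HH V) : (shf h W : V → ℂ) =ᵐ[volume] fun z => W (z + h) :=
  Lp.coeFn_compMeasurePreserving W (measurePreserving_add_right volume h)

/-- the character -/
def chr (h : V) (z : V) : ℂ := Complex.exp ((2 * π * inner ℝ z h : ℝ) * Complex.I)

lemma norm_chr (h z : V) : ‖chr h z‖ = 1 := by
  simp only [chr]; exact Complex.norm_exp_ofReal_mul_I _

lemma adm_chr (h : V) : Adm (chr h) := by
  refine Adm.of_bdd ?_ 1 (fun z => (norm_chr h z).le)
  unfold chr
  fun_prop

lemma shf_Sm {f : 𝓢(V, ℂ)} {m : V → ℂ} (hm : Adm m) (h : V) :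
    shf h (Sm f m) = Sm f (fun z => chr h z * m z) := by
  apply Lp.ext
  have e1 : (fun z => (Sm f m : V → ℂ) (z + h)) =ᵐ[volume]
      fun z => 𝓕⁻ (fun z => m z * f z) (z + h) :=
    (measurePreserving_add_right volume h).quasiMeasurePreserving.ae_eq (Sm_ae (f := f) hm)
  filter_upwards [shf_ae h (Sm f m), Sm_ae (f := f) ((adm_chr h).mul hm), e1] with z h1 h2 h3
  rw [h1, h2, h3, Real.fourierInv_eq', Real.fourierInv_eq']
  congr 1
  ext y
  simp only [chr, smul_eq_mul]
  rw [inner_add_right, mul_add, Complex.ofReal_add, add_mul, Complex.exp_add]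
  ring

lemma shf_neg_shf (h : V) (W : HH V) : shf (-h) (shf h W) = W := by
  apply Lp.ext
  have e1 : (fun z => (shf h W : V → ℂ) (z + -h)) =ᵐ[volume] fun z => W ((z + -h) + h) :=
    (measurePreserving_add_right volume (-h)).quasiMeasurePreserving.ae_eq (shf_ae h W)
  filter_upwards [shf_ae (-h) (shf h W), e1] with z h1 h2
  rw [h1, h2]; simp

lemma inner_shf_left (h : V) (W W' : HH V) :
    inner ℂ (shf h W) W' = inner ℂ W (shf (-h) W') := by
  rw [← (shf (-h)).inner_map_map, shf_neg_shf]

/-- admissible multiplication functions -/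
def BM (b : V → ℝ) : Prop := Measurable b ∧ ∃ C, ∀ z, |b z| ≤ C

lemma BM.memLp {b : V → ℝ} (hb : BM b) (W : HH V) : MemLp (fun z => (b z : ℂ) * W z) 2 volume := by
  obtain ⟨hm, C, hC⟩ := hb
  refine (Lp.memLp W).of_le_mul (c := C) ?_ (Filter.Eventually.of_forall fun z => ?_)
  · exact (Complex.measurable_ofReal.comp hm).aestronglyMeasurable.mul (Lp.memLp W).1
  · rw [norm_mul, Complex.norm_real]
    gcongr
    exact hC z

open Classical in
/-- multiplication operator -/
def Mu (b : V → ℝ) (W : HH V) : HH V :=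
  if h : MemLp (fun z => (b z : ℂ) * W z) 2 volume then h.toLp _ else 0

lemma Mu_ae {b : V → ℝ} (hb : BM b) (W : HH V) : (Mu b W : V → ℂ) =ᵐ[volume] fun z => (b z : ℂ) * W z := by
  simp only [Mu, hb.memLp W, dif_pos]
  exact MemLp.coeFn_toLp _

lemma Mu_add {b : V → ℝ} (hb : BM b) (W W' : HH V) : Mu b (W + W') = Mu b W + Mu b W' := by
  apply Lp.ext
  filter_upwards [Mu_ae hb W, Mu_ae hb W', Mu_ae hb (W + W'), Lp.coeFn_add W W',
    Lp.coeFn_add (Mu b W) (Mu b W')] with z h1 h2 h3 h4 h5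
  rw [h3, h5, h4, Pi.add_apply, Pi.add_apply, h1, h2, mul_add]

lemma Mu_sub {b : V → ℝ} (hb : BM b) (W W' : HH V) : Mu b (W - W') = Mu b W - Mu b W' := by
  rw [eq_sub_iff_add_eq, ← Mu_add hb, sub_add_cancel]

lemma Mu_norm_le {b : V → ℝ} (hb : BM b) {C : ℝ} (hC : ∀ z, |b z| ≤ C) (W : HH V) :
    ‖Mu b W‖ ≤ C * ‖W‖ := by
  apply Lp.norm_le_mul_norm_of_ae_le_mul
  filter_upwards [Mu_ae hb W] with z h1
  rw [h1, norm_mul, Complex.norm_real]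
  gcongr
  exact hC z

lemma Mu_diff {b b' : V → ℝ} (hb : BM b) (hb' : BM b') (W : HH V) :
    Mu b W - Mu b' W = Mu (fun z => b z - b' z) W := by
  have hbb : BM (fun z => b z - b' z) := by
    obtain ⟨h1, C, h2⟩ := hb
    obtain ⟨h1', C', h2'⟩ := hb'
    exact ⟨h1.sub h1', C + C', fun z => (abs_sub _ _).trans (add_le_add (h2 z) (h2' z))⟩
  apply Lp.ext
  filter_upwards [Mu_ae hb W, Mu_ae hb' W, Mu_ae hbb W,
    Lp.coeFn_sub (Mu b W) (Mu b' W)] with z h1 h2 h3 h5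
  rw [h3, h5, Pi.sub_apply, h1, h2]
  push_cast
  ring

lemma Mu_symm {b : V → ℝ} (hb : BM b) (W W' : HH V) :
    inner ℂ (Mu b W) W' = inner ℂ W (Mu b W') := by
  rw [L2.inner_def, L2.inner_def]
  apply integral_congr_ae
  filter_upwards [Mu_ae hb W, Mu_ae hb W'] with z h1 h2
  rw [h1, h2]
  simp only [RCLike.inner_apply, map_mul, Complex.conj_ofReal]
  ring

lemma Mu_lower {b : V → ℝ} (hb : BM b) {c : ℝ} (hc : ∀ z, c ≤ b z) (W : HH V) :
    c * ‖W‖ ^ 2 ≤ (inner ℂ W (Mu b W)).re := by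
  have h1 : ‖W‖ ^ 2 = (inner ℂ W W).re := by
    rw [inner_self_eq_norm_sq_to_K]; norm_cast
  rw [h1, L2.inner_def, L2.inner_def]
  have i1 := L2.integrable_inner (𝕜 := ℂ) W W
  have i2 := L2.integrable_inner (𝕜 := ℂ) W (Mu b W)
  change c * RCLike.re (∫ z, inner ℂ (W z) (W z)) ≤ RCLike.re (∫ z, inner ℂ (W z) (Mu b W z))
  rw [← integral_re i1, ← integral_re i2, ← integral_const_mul]
  apply integral_mono_ae (i1.re.const_mul _) i2.re
  filter_upwards [Mu_ae hb W] with z h1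
  rw [h1]
  have : inner ℂ (W z) ((b z : ℂ) * W z) = (b z : ℂ) * inner ℂ (W z) (W z) := by
    simp only [RCLike.inner_apply]; ring
  rw [this, inner_self_eq_norm_sq_to_K]
  have e : (((‖W z‖ : ℂ)) ^ 2) = ((‖W z‖ ^ 2 : ℝ) : ℂ) := by push_cast; rfl
  change c * ((‖W z‖ : ℂ) ^ 2).re ≤ ((b z : ℂ) * (‖W z‖ : ℂ) ^ 2).re
  rw [e, Complex.re_ofReal_mul, Complex.ofReal_re]
  gcongr
  exact hc z

lemma BM.shift {b : V → ℝ} (hb : BM b) (h : V) : BM (fun z => b (z + h)) :=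
  ⟨hb.1.comp (measurable_add_const h), hb.2.imp fun C hC z => hC _⟩

lemma shf_Mu {b : V → ℝ} (hb : BM b) (h : V) (W : HH V) :
    shf h (Mu b W) = Mu (fun z => b (z + h)) (shf h W) := by
  apply Lp.ext
  have e1 : (fun z => (Mu b W : V → ℂ) (z + h)) =ᵐ[volume] fun z => (b (z + h) : ℂ) * W (z + h) :=
    (measurePreserving_add_right volume h).quasiMeasurePreserving.ae_eq (Mu_ae hb W)
  filter_upwards [shf_ae h (Mu b W), shf_ae h W, e1, Mu_ae (hb.shift h) (shf h W)]
    with z h1 h2 h3 h4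
  rw [h1, h3, h4, h2]

end General

section Kernel

variable {EE : Type*} [NormedAddCommGroup EE] [InnerProductSpace ℝ EE] [FiniteDimensional ℝ EE]
  [MeasurableSpace EE] [BorelSpace EE] [Nontrivial EE]

def kr (θ : ℝ) (h : EE) : ℝ := ‖h‖ ^ (-((Module.finrank ℝ EE : ℝ) + θ))

lemma kr_nonneg (θ : ℝ) (h : EE) : 0 ≤ kr θ h := by unfold kr; positivity

lemma measurable_kr (θ : ℝ) : Measurable (kr θ : EE → ℝ) := by unfold kr; fun_prop

lemma integrable_kr (θ : ℝ) (q : ℕ) (h0 : 0 < θ) (h1 : θ < q) :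
    Integrable (fun h : EE => min 1 (‖h‖ ^ q) * kr θ h) := by
  unfold kr
  have hd : 1 ≤ Module.finrank ℝ EE := Module.finrank_pos
  rw [integrable_fun_norm_addHaar (μ := (volume : Measure EE))
    (f := fun y => min 1 (y ^ q) * y ^ (-((Module.finrank ℝ EE : ℝ) + θ)))]
  rw [← Set.Ioc_union_Ioi_eq_Ioi (zero_le_one (α := ℝ))]
  apply IntegrableOn.union
  · have : IntegrableOn (fun y : ℝ => y ^ ((q : ℝ) - θ - 1)) (Set.Ioc 0 1) := by
      have := intervalIntegral.intervalIntegrable_rpow' (a := 0) (b := 1) (r := (q : ℝ) - θ - 1)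
        (by linarith)
      rwa [intervalIntegrable_iff_integrableOn_Ioc_of_le zero_le_one] at this
    refine this.congr_fun (fun y hy => ?_) measurableSet_Ioc
    have hy0 : 0 < y := hy.1
    rw [min_eq_right (pow_le_one₀ hy0.le hy.2)]
    simp only [smul_eq_mul]
    rw [← Real.rpow_natCast, ← Real.rpow_natCast, ← Real.rpow_add hy0, ← Real.rpow_add hy0]
    congr 1
    push_cast [hd]
    ring
  · have : IntegrableOn (fun y : ℝ => y ^ (-1 - θ)) (Set.Ioi 1) :=
      integrableOn_Ioi_rpow_of_lt (by linarith) one_pos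
    refine this.congr_fun (fun y hy => ?_) measurableSet_Ioi
    have hy1 : 1 < y := hy
    have hy0 : 0 < y := by linarith
    rw [min_eq_left (one_le_pow₀ hy1.le)]
    simp only [smul_eq_mul, one_mul]
    rw [← Real.rpow_natCast, ← Real.rpow_add hy0]
    congr 1
    push_cast [hd]
    ring

/-- `2 - 2 cos` -/
def tc (η h : EE) : ℝ := 2 - 2 * Real.cos (2 * π * inner ℝ η h)

lemma tc_nonneg (η h : EE) : 0 ≤ tc η h := by
  unfold tc; linarith [Real.cos_le_one (2 * π * inner ℝ η h)]

lemma tc_le (η h : EE) : tc η h ≤ (4 + 4 * π ^ 2 * ‖η‖ ^ 2) * min 1 (‖h‖ ^ 2) := by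
  unfold tc
  have h1 := Real.neg_one_le_cos (2 * π * inner ℝ η h)
  have h2 := Real.one_sub_sq_div_two_le_cos (x := 2 * π * inner ℝ η h)
  have h3 : (inner ℝ η h) ^ 2 ≤ ‖η‖ ^ 2 * ‖h‖ ^ 2 := by
    rw [← mul_pow, ← sq_abs]
    gcongr
    exact abs_real_inner_le_norm η h
  have h4 : π ^ 2 * (inner ℝ η h) ^ 2 ≤ π ^ 2 * (‖η‖ ^ 2 * ‖h‖ ^ 2) := by gcongr
  rcases le_total 1 (‖h‖ ^ 2) with hh | hh
  · rw [min_eq_left hh]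
    have : 0 ≤ π ^ 2 * ‖η‖ ^ 2 := by positivity
    nlinarith
  · rw [min_eq_right hh]
    nlinarith [sq_nonneg ‖h‖]

lemma measurable_tc (η : EE) : Measurable (tc η) := by unfold tc; fun_prop

lemma integrable_tc (θ : ℝ) (h0 : 0 < θ) (h1 : θ < 2) (η : EE) :
    Integrable (fun h : EE => kr θ h * tc η h) := by
  refine ((integrable_kr (EE := EE) θ 2 h0 (by exact_mod_cast h1)).const_mul
    (4 + 4 * π ^ 2 * ‖η‖ ^ 2)).mono'
    ((measurable_kr θ).mul (measurable_tc η)).aestronglyMeasurable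
    (Filter.Eventually.of_forall fun h => ?_)
  rw [Real.norm_of_nonneg (mul_nonneg (kr_nonneg _ _) (tc_nonneg _ _))]
  calc _ ≤ kr θ h * ((4 + 4 * π ^ 2 * ‖η‖ ^ 2) * min 1 (‖h‖ ^ 2)) :=
        mul_le_mul_of_nonneg_left (tc_le η h) (kr_nonneg _ _)
    _ = _ := by ring

lemma tc_scale (θ : ℝ) (e : EE) (r : ℝ) (hr : 0 < r) :
    ∫ h, kr θ h * tc (r • e) h = r ^ θ * ∫ h, kr θ h * tc e h := by
  have h1 := Measure.integral_comp_smul (volume : Measure EE) (fun h => kr θ h * tc e h) r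
  have h2 : ∀ h : EE, kr θ (r • h) * tc e (r • h)
      = r ^ (-((Module.finrank ℝ EE : ℝ) + θ)) * (kr θ h * tc (r • e) h) := by
    intro h
    unfold kr tc
    rw [norm_smul, Real.norm_of_nonneg hr.le, Real.mul_rpow hr.le (norm_nonneg _),
      inner_smul_right, inner_smul_left]
    simp only [conj_trivial]
    ring
  simp only [h2] at h1
  rw [integral_const_mul, abs_of_pos (by positivity), smul_eq_mul, ← Real.rpow_natCast,
    ← Real.rpow_neg hr.le] at h1
  have h3 : r ^ ((Module.finrank ℝ EE : ℝ) + θ) * r ^ (-((Module.finrank ℝ EE : ℝ) + θ)) = 1 := by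
    rw [← Real.rpow_add hr]; simp
  have h4 : r ^ ((Module.finrank ℝ EE : ℝ) + θ) * r ^ (-(Module.finrank ℝ EE : ℝ)) = r ^ θ := by
    rw [← Real.rpow_add hr]; congr 1; ring
  calc ∫ h, kr θ h * tc (r • e) h
      = r ^ ((Module.finrank ℝ EE : ℝ) + θ) * (r ^ (-((Module.finrank ℝ EE : ℝ) + θ))
        * ∫ h, kr θ h * tc (r • e) h) := by rw [← mul_assoc, h3, one_mul]
    _ = _ := by rw [h1, ← mul_assoc, h4]

lemma tc_rot (θ : ℝ) (e e' : EE) (he : ‖e‖ = ‖e'‖) :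
    ∫ h, kr θ h * tc e h = ∫ h, kr θ h * tc e' h := by
  let R : EE ≃ₗᵢ[ℝ] EE := (ℝ ∙ (e - e'))ᗮ.reflection
  have hR : R e = e' := Submodule.reflection_sub he
  have := R.measurePreserving.integral_comp R.toHomeomorph.measurableEmbedding
    (fun h => kr θ h * tc e' h)
  rw [← this]
  congr 1
  ext h
  unfold kr tc
  rw [R.norm_map, ← hR, R.inner_map_map]

lemma tc_formula (EE : Type*) [NormedAddCommGroup EE] [InnerProductSpace ℝ EE] [FiniteDimensional ℝ EE]
    [MeasurableSpace EE] [BorelSpace EE] [Nontrivial EE] (θ : ℝ) (h0 : 0 < θ) (h1 : θ < 2) :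
    ∃ c : ℝ, 0 < c ∧ ∀ η : EE, ∫ h, kr θ h * tc η h = c * ‖η‖ ^ θ := by
  obtain ⟨e, he⟩ := exists_norm_eq EE (zero_le_one (α := ℝ))
  refine ⟨∫ h, kr θ h * tc e h, ?_, fun η => ?_⟩
  · rw [integral_pos_iff_support_of_nonneg
      (fun h => mul_nonneg (kr_nonneg _ _) (tc_nonneg _ _)) (integrable_tc θ h0 h1 e)]
    have hopen : IsOpen {h : EE | Real.cos (2 * π * inner ℝ e h) < 0} :=
      isOpen_lt (by fun_prop) continuous_const
    have hne : ((1 / 2 : ℝ) • e) ∈ {h : EE | Real.cos (2 * π * inner ℝ e h) < 0} := by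
      simp only [Set.mem_ofPred_eq, inner_smul_right, real_inner_self_eq_norm_sq, he]
      have : 2 * π * (1 / 2 * 1 ^ 2) = π := by ring
      rw [this]; simp
    refine lt_of_lt_of_le (hopen.measure_pos volume ⟨_, hne⟩) (measure_mono fun h hh => ?_)
    simp only [Set.mem_ofPred_eq] at hh
    have hh0 : h ≠ 0 := by
      rintro rfl
      simp at hh
      linarith
    simp only [Function.mem_support]
    have : 0 < kr θ h := by unfold kr; positivity
    have h2 : 0 < tc e h := by unfold tc; linarith
    positivity
  · rcases eq_or_ne η 0 with rfl | hη
    · simp [tc, Real.zero_rpow h0.ne']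
    · have hη' : 0 < ‖η‖ := norm_pos_iff.2 hη
      have : η = ‖η‖ • (‖η‖⁻¹ • η) := by rw [smul_smul, mul_inv_cancel₀ hη'.ne', one_smul]
      rw [this, tc_scale θ _ _ hη', tc_rot θ (‖η‖⁻¹ • η) e, ← this, mul_comm]
      rw [norm_smul, he, norm_inv, norm_norm, inv_mul_cancel₀ hη'.ne']

end Kernel

section Rep

variable {V : Type*} [NormedAddCommGroup V] [InnerProductSpace ℝ V] [FiniteDimensional ℝ V]
  [MeasurableSpace V] [BorelSpace V]
variable {EE : Type*} [NormedAddCommGroup EE] [InnerProductSpace ℝ EE] [FiniteDimensional ℝ EE]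
  [MeasurableSpace EE] [BorelSpace EE] [Nontrivial EE]

def dd (h : V) (U : HH V) : HH V := (2 : ℂ) • U - shf h U - shf (-h) U

lemma chr_add_neg (ι : EE →L[ℝ] V) (p : V → EE) (hp : ∀ h z, inner ℝ z (ι h) = inner ℝ (p z) h)
    (h : EE) (z : V) : (2 : ℂ) - chr (ι h) z - chr (-(ι h)) z = (tc (p z) h : ℂ) := by
  unfold chr tc
  rw [inner_neg_right, hp]
  push_cast
  rw [Complex.cos]
  ring_nf

lemma dd_Sm (ι : EE →L[ℝ] V) (p : V → EE) (hp : ∀ h z, inner ℝ z (ι h) = inner ℝ (p z) h)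
    {f : 𝓢(V, ℂ)} {m : V → ℂ} (hm : Adm m) (h : EE) :
    dd (ι h) (Sm f m) = Sm f (fun z => (tc (p z) h : ℂ) * m z) := by
  unfold dd
  rw [shf_Sm hm, shf_Sm hm, ← Sm_smul _ hm, ← Sm_sub (hm.smul 2) ((adm_chr _).mul hm),
    ← Sm_sub ((hm.smul 2).sub ((adm_chr _).mul hm)) ((adm_chr _).mul hm)]
  congr 1
  ext z
  rw [← chr_add_neg ι p hp]
  ring

lemma measurable_tc2 {p : V → EE} (hpm : Measurable p) :
    Measurable (fun x : V × EE => tc (p x.1) x.2) := by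
  unfold tc
  fun_prop

lemma adm_tc {p : V → EE} (hpm : Measurable p) (h : EE) : Adm (fun z => (tc (p z) h : ℂ)) := by
  refine Adm.of_bdd ?_ 4 (fun z => ?_)
  · refine Complex.measurable_ofReal.comp ?_
    unfold tc
    fun_prop
  · rw [Complex.norm_real, Real.norm_of_nonneg (tc_nonneg _ _)]
    unfold tc
    linarith [Real.neg_one_le_cos (2 * π * inner ℝ (p z) h)]

lemma rep_formula (ι : EE →L[ℝ] V) (p : V → EE) (hp : ∀ h z, inner ℝ z (ι h) = inner ℝ (p z) h)
    (hpm : Measurable p) {θ c : ℝ} (h0 : 0 < θ) (h1 : θ < 2)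
    (hc : ∀ η : EE, ∫ h, kr θ h * tc η h = c * ‖η‖ ^ θ)
    {f : 𝓢(V, ℂ)} {m : V → ℂ} (hm : Adm m) (hm' : Adm (fun z => ((‖p z‖ ^ θ : ℝ) : ℂ) * m z))
    (W : HH V) :
    Integrable (fun h : EE => (kr θ h : ℂ) * inner ℂ W (dd (ι h) (Sm f m))) ∧
    ∫ h : EE, (kr θ h : ℂ) * inner ℂ W (dd (ι h) (Sm f m)) =
      c * inner ℂ W (Sm f (fun z => ((‖p z‖ ^ θ : ℝ) : ℂ) * m z)) := by
  set G : V → ℂ := fun z => (m z * f z) * conj ((𝓕 W : HH V) z) with hG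
  set F : V × EE → ℂ := fun x => ((kr θ x.2 * tc (p x.1) x.2 : ℝ) : ℂ) * G x.1 with hF
  have hGm : AEStronglyMeasurable G volume := (integrable_Sm hm _).1
  have hFm : AEStronglyMeasurable F (volume.prod volume) := by
    apply AEStronglyMeasurable.mul
    · exact (Complex.measurable_ofReal.comp
        (((measurable_kr θ).comp measurable_snd).mul (measurable_tc2 hpm))).aestronglyMeasurable
    · exact hGm.comp_fst
  have hFi : Integrable F (volume.prod volume) := by
    rw [integrable_prod_iff hFm]
    refine ⟨Filter.Eventually.of_forall fun z => ?_, ?_⟩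
    · exact (Integrable.ofReal (𝕜 := ℂ) (integrable_tc θ h0 h1 (p z))).mul_const (G z)
    · have e : ∀ z, ∫ h : EE, ‖F (z, h)‖ = c * (‖p z‖ ^ θ * ‖G z‖) := by
        intro z
        have : ∀ h, ‖F (z, h)‖ = (kr θ h * tc (p z) h) * ‖G z‖ := by
          intro h
          simp only [hF, norm_mul, Complex.norm_real]
          rw [Real.norm_of_nonneg (kr_nonneg _ _), Real.norm_of_nonneg (tc_nonneg _ _)]
        simp only [this]
        rw [integral_mul_const, hc]
        ring
      simp only [e]
      have := (integrable_Sm (f := f) hm' (𝓕 W)).norm.const_mul c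
      refine this.congr (Filter.Eventually.of_forall fun z => ?_)
      simp only [hG, norm_mul, Complex.norm_real]
      rw [Real.norm_of_nonneg (by positivity : 0 ≤ ‖p z‖ ^ θ)]
      ring
  have e2 : ∀ h : EE, (kr θ h : ℂ) * inner ℂ W (dd (ι h) (Sm f m)) = ∫ z, F (z, h) := by
    intro h
    rw [dd_Sm ι p hp hm, inner_Sm ((adm_tc hpm h).mul hm), ← integral_const_mul]
    congr 1
    ext z
    simp only [hF, hG]
    push_cast
    ring
  simp only [e2]
  refine ⟨hFi.integral_prod_right, ?_⟩
  rw [← integral_integral_swap (f := fun z h => F (z, h)) hFi, inner_Sm hm', ← integral_const_mul]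
  congr 1
  ext z
  simp only [hF]
  rw [integral_mul_const, integral_complex_ofReal, hc]
  simp only [hG]
  push_cast
  ring

lemma inner_dd (h : V) (W U : HH V) :
    inner ℂ W (dd h U) = inner ℂ (shf h W - W) (shf h U - U) := by
  unfold dd
  simp only [inner_sub_left, inner_sub_right, inner_smul_right, (shf h).inner_map_map]
  rw [inner_shf_left h W U]
  ring

lemma energy (ι : EE →L[ℝ] V) (p : V → EE) (hp : ∀ h z, inner ℝ z (ι h) = inner ℝ (p z) h)
    (hpm : Measurable p) {θ c : ℝ} (h0 : 0 < θ) (h1 : θ < 2)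
    (hc : ∀ η : EE, ∫ h, kr θ h * tc η h = c * ‖η‖ ^ θ)
    {f : 𝓢(V, ℂ)} {m : V → ℂ} (hm : Adm m) (hm' : Adm (fun z => ((‖p z‖ ^ θ : ℝ) : ℂ) * m z))
    (hm2 : Adm (fun z => ((‖p z‖ ^ (θ / 2) : ℝ) : ℂ) * m z)) :
    Integrable (fun h : EE => kr θ h * ‖shf (ι h) (Sm f m) - Sm f m‖ ^ 2) ∧
    ∫ h : EE, kr θ h * ‖shf (ι h) (Sm f m) - Sm f m‖ ^ 2 =
      c * ‖Sm f (fun z => ((‖p z‖ ^ (θ / 2) : ℝ) : ℂ) * m z)‖ ^ 2 := by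
  obtain ⟨i1, i2⟩ := rep_formula ι p hp hpm h0 h1 hc (f := f) hm hm' (Sm f m)
  have e : ∀ h : EE, (kr θ h : ℂ) * inner ℂ (Sm f m) (dd (ι h) (Sm f m))
      = ((kr θ h * ‖shf (ι h) (Sm f m) - Sm f m‖ ^ 2 : ℝ) : ℂ) := by
    intro h
    rw [inner_dd, inner_self_eq_norm_sq_to_K]
    push_cast; rfl
  have e2 : inner ℂ (Sm f m) (Sm f (fun z => ((‖p z‖ ^ θ : ℝ) : ℂ) * m z))
      = ((‖Sm f (fun z => ((‖p z‖ ^ (θ / 2) : ℝ) : ℂ) * m z)‖ ^ 2 : ℝ) : ℂ) := by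
    rw [inner_Sm_Sm hm' hm, norm_Sm_sq hm2, ← integral_complex_ofReal]
    congr 1
    ext z
    have hz : ‖p z‖ ^ θ = (‖p z‖ ^ (θ / 2)) ^ 2 := by
      rw [← Real.rpow_natCast, ← Real.rpow_mul (norm_nonneg _)]
      congr 1; push_cast; ring
    have hq : ∀ w : ℂ, ((‖w‖ ^ 2 : ℝ) : ℂ) = w * conj w := by
      intro w; rw [Complex.mul_conj, Complex.normSq_eq_norm_sq]
    rw [hq, hz]
    simp only [map_mul, Complex.conj_ofReal]
    push_cast
    ring
  simp only [e] at i1 i2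
  rw [integral_complex_ofReal, e2] at i2
  constructor
  · exact i1.re.congr (Filter.Eventually.of_forall fun h => Complex.ofReal_re _)
  · exact_mod_cast i2

lemma diff_shf (ι : EE →L[ℝ] V) {a : V → ℝ} (ha : BM a) {L : ℝ}
    (hL : ∀ (h : EE) z, |a (z + ι h) - a z| ≤ L * min 1 ‖h‖) (h : EE) (U : HH V) :
    ∃ R : HH V, shf (ι h) (Mu a U) - Mu a U
      = Mu (fun z => a (z + ι h)) (shf (ι h) U - U) + R ∧ ‖R‖ ≤ L * min 1 ‖h‖ * ‖U‖ := by
  refine ⟨Mu (fun z => a (z + ι h) - a z) U, ?_, ?_⟩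
  · rw [shf_Mu ha, ← Mu_diff (ha.shift _) ha, Mu_sub (ha.shift _)]
    abel
  · apply Mu_norm_le _ (hL h)
    obtain ⟨C, hC⟩ := ha.2
    exact ⟨(ha.shift _).1.sub ha.1, C + C, fun z => (abs_sub _ _).trans (add_le_add (hC _) (hC z))⟩

lemma form_lower (ι : EE →L[ℝ] V) (p : V → EE) (hp : ∀ h z, inner ℝ z (ι h) = inner ℝ (p z) h)
    (hpm : Measurable p) {θ : ℝ} (h0 : 0 < θ) (h1 : θ < 2)
    {a : V → ℝ} (ha : BM a) {L : ℝ}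
    (hL : ∀ (h : EE) z, |a (z + ι h) - a z| ≤ L * min 1 ‖h‖) {a0 : ℝ} (ha0 : 0 < a0)
    (hlow : ∀ z, a0 ≤ a z) :
    ∃ C : ℝ, 0 ≤ C ∧ ∀ (f : 𝓢(V, ℂ)) (m : V → ℂ), Adm m →
      Adm (fun z => ((‖p z‖ ^ θ : ℝ) : ℂ) * m z) →
      Adm (fun z => ((‖p z‖ ^ (θ / 2) : ℝ) : ℂ) * m z) →
      a0 / 2 * ‖Sm f (fun z => ((‖p z‖ ^ (θ / 2) : ℝ) : ℂ) * m z)‖ ^ 2 - C * ‖Sm f m‖ ^ 2 ≤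
      (inner ℂ (Mu a (Sm f m)) (Sm f (fun z => ((‖p z‖ ^ θ : ℝ) : ℂ) * m z))).re := by
  obtain ⟨c, hc0, hc⟩ := tc_formula EE θ h0 h1
  have hk := integrable_kr (EE := EE) θ 2 h0 (by exact_mod_cast h1)
  set κ : ℝ := ∫ h : EE, min 1 (‖h‖ ^ 2) * kr θ h with hκ
  have hκ0 : 0 ≤ κ := integral_nonneg fun h => mul_nonneg (by positivity) (kr_nonneg _ _)
  refine ⟨c⁻¹ * (L ^ 2 / (2 * a0) * κ), by positivity, fun f m hm hm' hm2 => ?_⟩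
  obtain ⟨i1, i2⟩ := rep_formula ι p hp hpm h0 h1 hc (f := f) hm hm' (Mu a (Sm f m))
  obtain ⟨j1, j2⟩ := energy ι p hp hpm h0 h1 hc (f := f) hm hm' hm2
  set U := Sm f m with hU
  have key : ∀ h : EE, a0 / 2 * (kr θ h * ‖shf (ι h) U - U‖ ^ 2)
      - L ^ 2 / (2 * a0) * ‖U‖ ^ 2 * (min 1 (‖h‖ ^ 2) * kr θ h)
      ≤ ((kr θ h : ℂ) * inner ℂ (Mu a U) (dd (ι h) U)).re := by
    intro h
    rw [Complex.re_ofReal_mul, inner_dd]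
    obtain ⟨R, hR1, hR2⟩ := diff_shf ι ha hL h U
    rw [hR1, inner_add_left, Complex.add_re]
    set D := shf (ι h) U - U with hD
    have k1 : a0 * ‖D‖ ^ 2 ≤ (inner ℂ (Mu (fun z => a (z + ι h)) D) D).re := by
      rw [Mu_symm (ha.shift _)]
      exact Mu_lower (ha.shift _) (fun z => hlow _) D
    have k2 : -(‖R‖ * ‖D‖) ≤ (inner ℂ R D).re := by
      have := (Complex.abs_re_le_norm _).trans (norm_inner_le_norm (𝕜 := ℂ) R D)
      exact (abs_le.1 this).1
    have k3 : ‖R‖ * ‖D‖ ≤ a0 / 2 * ‖D‖ ^ 2 + ‖R‖ ^ 2 / (2 * a0) := by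
      have : 0 ≤ (a0 * ‖D‖ - ‖R‖) ^ 2 / (2 * a0) := by positivity
      have e : (a0 * ‖D‖ - ‖R‖) ^ 2 / (2 * a0)
        = a0 / 2 * ‖D‖ ^ 2 + ‖R‖ ^ 2 / (2 * a0) - ‖R‖ * ‖D‖ := by field_simp; ring
      linarith
    have k4 : ‖R‖ ^ 2 ≤ L ^ 2 * min 1 (‖h‖ ^ 2) * ‖U‖ ^ 2 := by
      have : min 1 (‖h‖ ^ 2) = (min 1 ‖h‖) ^ 2 := by
        rcases le_total 1 ‖h‖ with hh | hh
        · rw [min_eq_left hh, min_eq_left (one_le_pow₀ hh)]; simp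
        · rw [min_eq_right hh, min_eq_right (pow_le_one₀ (norm_nonneg _) hh)]
      rw [this, ← mul_pow, ← mul_pow]
      gcongr
    have k5 : ‖R‖ ^ 2 / (2 * a0) ≤ L ^ 2 * min 1 (‖h‖ ^ 2) * ‖U‖ ^ 2 / (2 * a0) := by gcongr
    have k6 : a0 / 2 * ‖D‖ ^ 2 - L ^ 2 * min 1 (‖h‖ ^ 2) * ‖U‖ ^ 2 / (2 * a0)
      ≤ (inner ℂ (Mu (fun z => a (z + ι h)) D) D).re + (inner ℂ R D).re := by linarith
    have := mul_le_mul_of_nonneg_left k6 (kr_nonneg θ h)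
    refine le_trans (le_of_eq ?_) this
    ring
  have m1 := integral_mono ((j1.const_mul (a0 / 2)).sub
    (hk.const_mul (L ^ 2 / (2 * a0) * ‖U‖ ^ 2))) i1.re key
  have m2 : ∫ h : EE, RCLike.re ((kr θ h : ℂ) * inner ℂ (Mu a U) (dd (ι h) U))
     = (c * inner ℂ (Mu a U) (Sm f (fun z => ((‖p z‖ ^ θ : ℝ) : ℂ) * m z))).re := by
    rw [integral_re i1, i2]; rfl
  simp only [Pi.sub_apply] at m1
  rw [integral_sub (j1.const_mul _) (hk.const_mul _), integral_const_mul, integral_const_mul, j2,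
    ← hκ, m2, Complex.re_ofReal_mul] at m1
  have m3 := mul_le_mul_of_nonneg_left m1 (inv_nonneg.2 hc0.le)
  rw [← mul_assoc c⁻¹ c, inv_mul_cancel₀ hc0.ne', one_mul] at m3
  refine le_trans (le_of_eq ?_) m3
  field_simp

lemma form_upper (ι : EE →L[ℝ] V) (p : V → EE) (hp : ∀ h z, inner ℝ z (ι h) = inner ℝ (p z) h)
    (hpm : Measurable p) {θ : ℝ} (h0 : 0 < θ) (h1 : θ < 2)
    {a : V → ℝ} (ha : BM a) {L : ℝ}
    (hL : ∀ (h : EE) z, |a (z + ι h) - a z| ≤ L * min 1 ‖h‖) {K : ℝ} 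
    (hK : ∀ z, |a z| ≤ K) :
    ∃ C : ℝ, 0 ≤ C ∧ ∀ (f : 𝓢(V, ℂ)) (m m' : V → ℂ), Adm m →
      Adm (fun z => ((‖p z‖ ^ θ : ℝ) : ℂ) * m z) →
      Adm (fun z => ((‖p z‖ ^ (θ / 2) : ℝ) : ℂ) * m z) → Adm m' →
      Adm (fun z => ((‖p z‖ ^ θ : ℝ) : ℂ) * m' z) →
      Adm (fun z => ((‖p z‖ ^ (θ / 2) : ℝ) : ℂ) * m' z) →
      ‖inner ℂ (Mu a (Sm f m')) (Sm f (fun z => ((‖p z‖ ^ θ : ℝ) : ℂ) * m z))‖ ≤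
       C * (‖Sm f (fun z => ((‖p z‖ ^ (θ / 2) : ℝ) : ℂ) * m z)‖ ^ 2 
        + ‖Sm f (fun z => ((‖p z‖ ^ (θ / 2) : ℝ) : ℂ) * m' z)‖ ^ 2 + ‖Sm f m'‖ ^ 2) := by
  obtain ⟨c, hc0, hc⟩ := tc_formula EE θ h0 h1
  have hk := integrable_kr (EE := EE) θ 2 h0 (by exact_mod_cast h1)
  set κ : ℝ := ∫ h : EE, min 1 (‖h‖ ^ 2) * kr θ h with hκ
  have hκ0 : 0 ≤ κ := integral_nonneg fun h => mul_nonneg (by positivity) (kr_nonneg _ _)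
  refine ⟨c⁻¹ * (1 * c + K ^ 2 * c + L ^ 2 * κ), by positivity, fun f m m' hm hm' hm2 hn hn' hn2 => ?_⟩
  obtain ⟨i1, i2⟩ := rep_formula ι p hp hpm h0 h1 hc (f := f) hm hm' (Mu a (Sm f m'))
  obtain ⟨j1, j2⟩ := energy ι p hp hpm h0 h1 hc (f := f) hm hm' hm2
  obtain ⟨l1, l2⟩ := energy ι p hp hpm h0 h1 hc (f := f) hn hn' hn2
  set U := Sm f m with hU
  set U' := Sm f m' with hU'
  have key : ∀ h : EE, ‖(kr θ h : ℂ) * inner ℂ (Mu a U') (dd (ι h) U)‖ ≤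
      1 * (kr θ h * ‖shf (ι h) U - U‖ ^ 2) + K ^ 2 * (kr θ h * ‖shf (ι h) U' - U'‖ ^ 2)
      + L ^ 2 * ‖U'‖ ^ 2 * (min 1 (‖h‖ ^ 2) * kr θ h) := by
    intro h
    rw [norm_mul, Complex.norm_real, Real.norm_of_nonneg (kr_nonneg _ _), inner_dd]
    obtain ⟨R, hR1, hR2⟩ := diff_shf ι ha hL h U'
    rw [hR1, inner_add_left]
    set D := shf (ι h) U - U with hD
    set D' := shf (ι h) U' - U' with hD'
    have k1 : ‖inner ℂ (Mu (fun z => a (z + ι h)) D') D‖ ≤ K * ‖D'‖ * ‖D‖ :=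
      (norm_inner_le_norm _ _).trans (by
        gcongr
        exact Mu_norm_le (ha.shift _) (fun z => hK _) D')
    have k2 : ‖inner ℂ R D‖ ≤ ‖R‖ * ‖D‖ := norm_inner_le_norm _ _
    have k4 : ‖R‖ ^ 2 ≤ L ^ 2 * min 1 (‖h‖ ^ 2) * ‖U'‖ ^ 2 := by
      have : min 1 (‖h‖ ^ 2) = (min 1 ‖h‖) ^ 2 := by
        rcases le_total 1 ‖h‖ with hh | hh
        · rw [min_eq_left hh, min_eq_left (one_le_pow₀ hh)]; simp
        · rw [min_eq_right hh, min_eq_right (pow_le_one₀ (norm_nonneg _) hh)]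
      rw [this, ← mul_pow, ← mul_pow]
      gcongr
    have k6 : ‖inner ℂ (Mu (fun z => a (z + ι h)) D') D + inner ℂ R D‖ ≤
        ‖D‖ ^ 2 + K ^ 2 * ‖D'‖ ^ 2 + L ^ 2 * min 1 (‖h‖ ^ 2) * ‖U'‖ ^ 2 := by
      have := norm_add_le (inner ℂ (Mu (fun z => a (z + ι h)) D') D) (inner ℂ R D)
      nlinarith [sq_nonneg (K * ‖D'‖ - ‖D‖), sq_nonneg (‖R‖ - ‖D‖), sq_nonneg (K * ‖D'‖), sq_nonneg ‖R‖]
    have := mul_le_mul_of_nonneg_left k6 (kr_nonneg θ h)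
    refine le_trans this (le_of_eq ?_)
    ring
  have m1 := norm_integral_le_of_norm_le (((j1.const_mul 1).add (l1.const_mul (K ^ 2))).add
    (hk.const_mul (L ^ 2 * ‖U'‖ ^ 2))) (Filter.Eventually.of_forall key)
  simp only [Pi.add_apply] at m1
  have s1 : Integrable (fun h : EE => 1 * (kr θ h * ‖shf (ι h) U - U‖ ^ 2)
      + K ^ 2 * (kr θ h * ‖shf (ι h) U' - U'‖ ^ 2)) := (j1.const_mul 1).add (l1.const_mul (K ^ 2))
  rw [integral_add s1 (hk.const_mul _),
    integral_add (j1.const_mul _) (l1.const_mul _), integral_const_mul, integral_const_mul,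
    integral_const_mul, j2, l2,
    ← hκ, i2, norm_mul, Complex.norm_real, Real.norm_of_nonneg hc0.le] at m1
  have m3 := mul_le_mul_of_nonneg_left m1 (inv_nonneg.2 hc0.le)
  rw [← mul_assoc c⁻¹ c, inv_mul_cancel₀ hc0.ne', one_mul] at m3
  refine m3.trans ?_
  rw [mul_assoc c⁻¹]
  refine mul_le_mul_of_nonneg_left ?_ (inv_nonneg.2 hc0.le)
  have q1 := sq_nonneg ‖Sm f (fun z => ((‖p z‖ ^ (θ / 2) : ℝ) : ℂ) * m z)‖
  have q2 := sq_nonneg ‖Sm f (fun z => ((‖p z‖ ^ (θ / 2) : ℝ) : ℂ) * m' z)‖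
  have q3 := sq_nonneg ‖U'‖
  set A1 := ‖Sm f (fun z => ((‖p z‖ ^ (θ / 2) : ℝ) : ℂ) * m z)‖ ^ 2
  set A2 := ‖Sm f (fun z => ((‖p z‖ ^ (θ / 2) : ℝ) : ℂ) * m' z)‖ ^ 2
  set A3 := ‖U'‖ ^ 2
  have p1 : 0 ≤ K ^ 2 * c := by positivity
  have p2 : 0 ≤ L ^ 2 * κ := by positivity
  nlinarith [mul_nonneg p1 q1, mul_nonneg p1 q3, mul_nonneg p2 q1, mul_nonneg p2 q2,
    mul_nonneg hc0.le q2, mul_nonneg hc0.le q3]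

lemma commut (ι : EE →L[ℝ] V) (p : V → EE) (hp : ∀ h z, inner ℝ z (ι h) = inner ℝ (p z) h)
    (hpm : Measurable p) {θ : ℝ} (h0 : 0 < θ) (h1 : θ < 1)
    {a : V → ℝ} (ha : BM a) {L : ℝ}
    (hL : ∀ (h : EE) z, |a (z + ι h) - a z| ≤ L * min 1 ‖h‖) :
    ∃ C : ℝ, 0 ≤ C ∧ ∀ (f : 𝓢(V, ℂ)) (m m' : V → ℂ), Adm m →
      Adm (fun z => ((‖p z‖ ^ θ : ℝ) : ℂ) * m z) → Adm m' →
      Adm (fun z => ((‖p z‖ ^ θ : ℝ) : ℂ) * m' z) →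
      ‖inner ℂ (Mu a (Sm f m)) (Sm f (fun z => ((‖p z‖ ^ θ : ℝ) : ℂ) * m' z)) -
        conj (inner ℂ (Mu a (Sm f m')) (Sm f (fun z => ((‖p z‖ ^ θ : ℝ) : ℂ) * m z)))‖ ≤
       C * ‖Sm f m‖ * ‖Sm f m'‖ := by
  obtain ⟨c, hc0, hc⟩ := tc_formula EE θ h0 (by linarith)
  have hk := integrable_kr (EE := EE) θ 1 h0 (by exact_mod_cast h1)
  set κ : ℝ := ∫ h : EE, min 1 (‖h‖ ^ 1) * kr θ h with hκ
  have hκ0 : 0 ≤ κ := integral_nonneg fun h => mul_nonneg (by positivity) (kr_nonneg _ _)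
  refine ⟨c⁻¹ * (2 * |L| * κ), by positivity, fun f m m' hm hm' hn hn' => ?_⟩
  obtain ⟨i1, i2⟩ := rep_formula ι p hp hpm h0 (by linarith) hc (f := f) hn hn' (Mu a (Sm f m))
  obtain ⟨j1, j2⟩ := rep_formula ι p hp hpm h0 (by linarith) hc (f := f) hm hm' (Mu a (Sm f m'))
  set U := Sm f m with hU
  set U' := Sm f m' with hU'
  have half : ∀ (h : EE), ‖inner ℂ (shf (ι (-h)) U) (Mu a U') - inner ℂ (Mu a U) (shf (ι h) U')‖
      ≤ |L| * min 1 ‖h‖ * ‖U‖ * ‖U'‖ := by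
    intro h
    rw [inner_shf_left, ← map_neg, neg_neg, shf_Mu ha, Mu_symm ha, ← inner_sub_right,
      Mu_diff (ha.shift _) ha]
    refine (norm_inner_le_norm _ _).trans ?_
    have : ‖Mu (fun z => a (z + ι h) - a z) (shf (ι h) U')‖ ≤ (|L| * min 1 ‖h‖) * ‖shf (ι h) U'‖ := by
      apply Mu_norm_le
      · obtain ⟨C, hC⟩ := ha.2
        exact ⟨(ha.shift _).1.sub ha.1, C + C,
          fun z => (abs_sub _ _).trans (add_le_add (hC _) (hC z))⟩
      · intro z
        refine (hL h z).trans ?_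
        gcongr
        exact le_abs_self L
    rw [(shf (ι h)).norm_map] at this
    calc _ ≤ ‖U‖ * (|L| * min 1 ‖h‖ * ‖U'‖) := by gcongr
      _ = _ := by ring
  have key : ∀ h : EE, ‖(kr θ h : ℂ) * inner ℂ (Mu a U) (dd (ι h) U')
      - conj ((kr θ h : ℂ) * inner ℂ (Mu a U') (dd (ι h) U))‖ ≤
      2 * |L| * ‖U‖ * ‖U'‖ * (min 1 (‖h‖ ^ 1) * kr θ h) := by
    intro h
    have e1 : (kr θ h : ℂ) * inner ℂ (Mu a U) (dd (ι h) U')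
      - conj ((kr θ h : ℂ) * inner ℂ (Mu a U') (dd (ι h) U))
      = (kr θ h : ℂ) * ((inner ℂ (shf (ι (-h)) U) (Mu a U') - inner ℂ (Mu a U) (shf (ι h) U'))
        + (inner ℂ (shf (ι h) U) (Mu a U') - inner ℂ (Mu a U) (shf (ι (-h)) U'))) := by
      rw [map_mul, inner_conj_symm, Complex.conj_ofReal, ← mul_sub]
      congr 1
      unfold dd
      simp only [inner_sub_left, inner_sub_right, inner_smul_right, inner_smul_left, map_neg]
      rw [Mu_symm ha U U']
      have : conj (2 : ℂ) = 2 := Complex.conj_ofNat 2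
      rw [this]
      ring
    rw [e1, norm_mul, Complex.norm_real, Real.norm_of_nonneg (kr_nonneg _ _)]
    have b1 := half h
    have b2 := half (-h)
    rw [neg_neg, norm_neg] at b2
    have := (norm_add_le _ _).trans (add_le_add b1 b2)
    refine (mul_le_mul_of_nonneg_left this (kr_nonneg θ h)).trans (le_of_eq ?_)
    rw [pow_one]
    ring
  have m1 := norm_integral_le_of_norm_le (hk.const_mul (2 * |L| * ‖U‖ * ‖U'‖))
    (Filter.Eventually.of_forall key)
  have j3 : Integrable fun h : EE => conj ((kr θ h : ℂ) * inner ℂ (Mu a U') (dd (ι h) U)) := by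
    exact (Complex.conjCLE.toContinuousLinearMap).integrable_comp j1
  rw [integral_sub i1 j3, integral_conj, i2, j2, integral_const_mul, ← hκ, map_mul,
    Complex.conj_ofReal, ← mul_sub, norm_mul, Complex.norm_real, Real.norm_of_nonneg hc0.le] at m1
  have m3 := mul_le_mul_of_nonneg_left m1 (inv_nonneg.2 hc0.le)
  rw [← mul_assoc c⁻¹ c, inv_mul_cancel₀ hc0.ne', one_mul] at m3
  refine m3.trans (le_of_eq ?_)
  ring

end Rep

section Kin

open LineDeriv

/-- the unit vector in the `vᵢ` direction -/
def eV (i : Fin n) : Z n := EuclideanSpace.single (Sum.inr (Sum.inr i)) 1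

lemma inner_eT (z : Z n) : inner ℝ z eT = tC z := by
  rw [eT, EuclideanSpace.inner_single_right]
  simp [tC]

lemma inner_eX (z : Z n) (i : Fin n) : inner ℝ z (eX i) = xC z i := by
  rw [eX, EuclideanSpace.inner_single_right]
  simp [xC]

lemma inner_eV (z : Z n) (i : Fin n) : inner ℝ z (eV i) = vC z i := by
  rw [eV, EuclideanSpace.inner_single_right]
  simp [vC]

lemma xC_add_eV (z : Z n) (i : Fin n) (t : ℝ) : xC (z + t • eV i) = xC z := by
  ext j
  simp [xC, eV]

lemma vC_add_eV (z : Z n) (i : Fin n) (t : ℝ) :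
    vC (z + t • eV i) = vC z + t • EuclideanSpace.single i 1 := by
  ext j
  by_cases h : j = i
  · subst h; simp [vC, eV]
  · simp [vC, eV, h]

/-- `x` embedding -/
def ιx : E n →L[ℝ] Z n := LinearMap.toContinuousLinearMap
  { toFun := fun h => WithLp.toLp 2 (Sum.elim (fun _ => 0) (Sum.elim (fun i => h i) (fun _ => 0)))
    map_add' := by
      intro x y; ext j; rcases j with j | j | j <;> simp
    map_smul' := by
      intro x y; ext j; rcases j with j | j | j <;> simp }

/-- `v` embedding -/
def ιv : E n →L[ℝ] Z n := LinearMap.toContinuousLinearMap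
  { toFun := fun h => WithLp.toLp 2 (Sum.elim (fun _ => 0) (Sum.elim (fun _ => 0) (fun i => h i)))
    map_add' := by
      intro x y; ext j; rcases j with j | j | j <;> simp
    map_smul' := by
      intro x y; ext j; rcases j with j | j | j <;> simp }

lemma inner_ιx (h : E n) (z : Z n) : inner ℝ z (ιx h) = inner ℝ (xC z) h := by
  simp [PiLp.inner_apply, ιx, xC]

lemma inner_ιv (h : E n) (z : Z n) : inner ℝ z (ιv h) = inner ℝ (vC z) h := by
  simp [PiLp.inner_apply, ιv, vC]

lemma norm_ιx (h : E n) : ‖ιx h‖ = ‖h‖ := by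
  simp [EuclideanSpace.norm_eq, ιx]

lemma norm_ιv (h : E n) : ‖ιv h‖ = ‖h‖ := by
  simp [EuclideanSpace.norm_eq, ιv]

lemma norm_xC_le (z : Z n) : ‖xC z‖ ≤ ‖z‖ := by
  rw [EuclideanSpace.norm_eq, EuclideanSpace.norm_eq]
  apply Real.sqrt_le_sqrt
  simp only [Fintype.sum_sum_type, xC]
  have h1 : 0 ≤ ∑ x : Unit, ‖z (Sum.inl x)‖ ^ 2 := Finset.sum_nonneg fun _ _ => by positivity
  have h2 : 0 ≤ ∑ x : Fin n, ‖z (Sum.inr (Sum.inr x))‖ ^ 2 :=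
    Finset.sum_nonneg fun _ _ => by positivity
  linarith

lemma norm_vC_le (z : Z n) : ‖vC z‖ ≤ ‖z‖ := by
  rw [EuclideanSpace.norm_eq, EuclideanSpace.norm_eq]
  apply Real.sqrt_le_sqrt
  simp only [Fintype.sum_sum_type, vC]
  have h1 : 0 ≤ ∑ x : Unit, ‖z (Sum.inl x)‖ ^ 2 := Finset.sum_nonneg fun _ _ => by positivity
  have h2 : 0 ≤ ∑ x : Fin n, ‖z (Sum.inr (Sum.inl x))‖ ^ 2 :=
    Finset.sum_nonneg fun _ _ => by positivity
  linarith

@[fun_prop]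
lemma continuous_xC : Continuous (xC : Z n → E n) := by
  unfold xC; fun_prop

@[fun_prop]
lemma continuous_vC : Continuous (vC : Z n → E n) := by
  unfold vC; fun_prop

@[fun_prop]
lemma measurable_xC : Measurable (xC : Z n → E n) := continuous_xC.measurable

@[fun_prop]
lemma measurable_vC : Measurable (vC : Z n → E n) := continuous_vC.measurable

/-- `(∂_t + v ∂_x) u` -/
def uX (u : 𝓢(Z n, ℂ)) : 𝓢(Z n, ℂ) :=
  ∂_{(eT : Z n)} u + ∑ i : Fin n, smulLeftCLM ℂ (fun z : Z n => inner ℝ z (eV i)) (∂_{(eX i : Z n)} u)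

lemma uX_apply (u : 𝓢(Z n, ℂ)) (z : Z n) :
    uX u z = fderiv ℝ u z eT + ∑ i : Fin n, (vC z i : ℂ) * fderiv ℝ u z (eX i) := by
  have : ∀ i : Fin n, (fun z : Z n => inner ℝ z (eV i)).HasTemperateGrowth := fun i => by fun_prop
  unfold uX
  rw [add_apply, sum_apply, SchwartzMap.lineDerivOp_apply_eq_fderiv]
  congr 1
  apply Finset.sum_congr rfl
  intro i _
  rw [smulLeftCLM_apply_apply (this i), SchwartzMap.lineDerivOp_apply_eq_fderiv, inner_eV]
  simp

lemma eV_eX (i : Fin n) : inner ℝ (eV i) (eX i : Z n) = 0 := by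
  rw [inner_eX]
  simp [eV, xC]

lemma fourier_uX (u : 𝓢(Z n, ℂ)) (z : Z n) :
    (𝓕 (uX u)) z = 2 * π * Complex.I * tC z * (𝓕 u) z
      - ∑ i : Fin n, (xC z i : ℂ) * fderiv ℝ (𝓕 u : 𝓢(Z n, ℂ)) z (eV i) := by
  have tg : ∀ m : Z n, (fun z : Z n => inner ℝ z m).HasTemperateGrowth := fun i => by fun_prop
  have hpi : (2 * π * Complex.I : ℂ) ≠ 0 := by
    simp [Real.pi_ne_zero]
  have h1 : 𝓕 (∂_{(eT : Z n)} u) z = 2 * π * Complex.I * tC z * (𝓕 u) z := by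
    rw [SchwartzMap.fourier_lineDerivOp_eq]
    rw [smul_apply, smulLeftCLM_apply_apply (tg _), inner_eT]
    simp [mul_assoc]
  have h2 : ∀ i : Fin n, 𝓕 (smulLeftCLM ℂ (fun z : Z n => inner ℝ z (eV i)) (∂_{(eX i : Z n)} u)) z
      = - ((xC z i : ℂ) * fderiv ℝ (𝓕 u : 𝓢(Z n, ℂ)) z (eV i)) := by
    intro i
    have e1 := congrArg (fun g : 𝓢(Z n, ℂ) => g z)
      (SchwartzMap.lineDerivOp_fourier_eq (∂_{(eX i : Z n)} u) (eV i))
    simp only [FourierTransform.fourier_smul, smul_apply] at e1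
    rw [SchwartzMap.fourier_lineDerivOp_eq, SchwartzMap.lineDerivOp_apply_eq_fderiv] at e1
    have e2 : HasFDerivAt (((2 * π * Complex.I : ℂ) • smulLeftCLM ℂ (fun z : Z n => inner ℝ z (eX i)) (𝓕 u) : 𝓢(Z n, ℂ)) : Z n → ℂ)
      ((2 * π * Complex.I : ℂ) • ((inner ℝ z (eX i)) • fderiv ℝ (𝓕 u : 𝓢(Z n, ℂ)) z
        + ((innerSL ℝ (eX i : Z n))).smulRight ((𝓕 u) z))) z := by
      have : (((2 * π * Complex.I : ℂ) • smulLeftCLM ℂ (fun z : Z n => inner ℝ z (eX i)) (𝓕 u) : 𝓢(Z n, ℂ)) : Z n → ℂ)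
        = fun z => (2 * π * Complex.I : ℂ) • ((inner ℝ (eX i) z) • (𝓕 u) z) := by
        ext y
        rw [smul_apply, smulLeftCLM_apply_apply (tg _), real_inner_comm]
      rw [this, real_inner_comm]
      have d1 : HasFDerivAt (fun z : Z n => (inner ℝ (eX i) z : ℝ)) (innerSL ℝ (eX i : Z n)) z :=
        (innerSL ℝ (eX i : Z n)).hasFDerivAt
      have d2 : HasFDerivAt (𝓕 u : 𝓢(Z n, ℂ)) (fderiv ℝ (𝓕 u : 𝓢(Z n, ℂ)) z) z :=
        (𝓕 u : 𝓢(Z n, ℂ)).differentiableAt.hasFDerivAt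
      exact (d1.smul d2).const_smul (2 * π * Complex.I : ℂ)
    rw [e2.fderiv] at e1
    simp only [smul_apply, add_apply,
      ContinuousLinearMap.smulRight_apply, innerSL_apply_apply] at e1
    rw [real_inner_comm (eV i) (eX i), eV_eX, zero_smul, add_zero, inner_eX, smul_eq_mul, smul_eq_mul,
      neg_mul, ← mul_neg] at e1
    have := mul_left_cancel₀ hpi e1
    rw [eq_comm, neg_eq_iff_eq_neg] at this
    rw [this]; simp
  unfold uX
  rw [FourierTransform.fourier_add, add_apply, h1]
  have h3 : 𝓕 (∑ i : Fin n, smulLeftCLM ℂ (fun z : Z n => inner ℝ z (eV i)) (∂_{(eX i : Z n)} u))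
    = ∑ i : Fin n, 𝓕 (smulLeftCLM ℂ (fun z : Z n => inner ℝ z (eV i)) (∂_{(eX i : Z n)} u)) :=
    map_sum (FourierTransform.fourierCLM ℂ 𝓢(Z n, ℂ)) _ _
  rw [h3, sum_apply, Finset.sum_congr rfl (fun i _ => h2 i), Finset.sum_neg_distrib]
  ring

lemma adm_integrable2 {V : Type*} [NormedAddCommGroup V] [InnerProductSpace ℝ V]
    [FiniteDimensional ℝ V] [MeasurableSpace V] [BorelSpace V] {m : V → ℂ} (hm : Adm m)
    (f g : 𝓢(V, ℂ)) : Integrable (fun z => m z * f z * conj (g z)) := by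
  have := MemLp.integrable_mul (p := 2) (q := 2) (hm.memLp f) (g.memLp 2 volume).star
  exact this

/-- `Xu` in L² -/
def Xu (u : 𝓢(Z n, ℂ)) : HH (Z n) := (uX u).toLp 2 volume

lemma transport (u : 𝓢(Z n, ℂ)) {b : Z n → ℝ} {b' : Fin n → Z n → ℝ} (hb : Adm (fun z => (b z : ℂ)))
    (hb' : ∀ i, Adm (fun z => (b' i z : ℂ))) (hd : ∀ i z, HasLineDerivAt ℝ b (b' i z) z (eV i)) :
    Integrable (fun z => (∑ i, xC z i * b' i z) * ‖(𝓕 u) z‖ ^ 2) ∧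
    (inner ℂ (Xu u) (Sm (𝓕 u) (fun z => (b z : ℂ)))).re =
      1 / 2 * ∫ z, (∑ i, xC z i * b' i z) * ‖(𝓕 u) z‖ ^ 2 := by
  set f : 𝓢(Z n, ℂ) := 𝓕 u with hf
  have hx : ∀ i, Adm (fun z : Z n => (xC z i : ℂ)) := by
    intro i
    refine ⟨by fun_prop, 1, 1, fun z => ?_⟩
    rw [Complex.norm_real, one_mul, pow_one]
    have := (PiLp.norm_apply_le (xC z) i).trans (norm_xC_le z)
    linarith
  have ht : Adm (fun z : Z n => (tC z : ℂ)) := by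
    refine ⟨by unfold tC; fun_prop, 1, 1, fun z => ?_⟩
    rw [Complex.norm_real, one_mul, pow_one]
    have := (PiLp.norm_apply_le z (Sum.inl ()))
    unfold tC
    linarith
  have hq : ∀ w : ℂ, (w * conj w) = ((‖w‖ ^ 2 : ℝ) : ℂ) := by
    intro w; rw [Complex.mul_conj, Complex.normSq_eq_norm_sq]
  have i0 : ∀ m : Z n → ℝ, Adm (fun z => (m z : ℂ)) → Integrable (fun z => m z * ‖f z‖ ^ 2) := by
    intro m hm
    refine (adm_integrable2 hm f f).re.congr (Filter.Eventually.of_forall fun z => ?_)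
    have : (m z : ℂ) * f z * conj (f z) = ((m z * ‖f z‖ ^ 2 : ℝ) : ℂ) := by
      rw [mul_assoc, hq]; push_cast; rfl
    simp only [this]; exact Complex.ofReal_re _
  have i1 : ∀ i, Integrable (fun z => (xC z i * b' i z) * ‖f z‖ ^ 2) := by
    intro i
    apply i0
    have := (hx i).mul (hb' i)
    simpa using this
  have i1' : Integrable (fun z => (∑ i, xC z i * b' i z) * ‖f z‖ ^ 2) := by
    simp only [Finset.sum_mul]
    exact integrable_finsetSum _ fun i _ => i1 i
  refine ⟨i1', ?_⟩
  set g : Fin n → 𝓢(Z n, ℂ) := fun i => ∂_{(eV i : Z n)} f with hg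
  have i2 : ∀ i, Integrable (fun z => ((b z * xC z i : ℝ) : ℂ) * f z * conj (g i z)) := by
    intro i
    apply adm_integrable2
    have := hb.mul (hx i)
    simpa using this
  have ibp : ∀ i, ∫ z, (b z * xC z i) * (2 * (f z * conj (g i z)).re)
      = - ∫ z, (xC z i * b' i z) * ‖f z‖ ^ 2 := by
    intro i
    have key := integral_bilinear_hasLineDerivAt_right_eq_neg_left_of_integrable
      (μ := (volume : Measure (Z n))) (f := fun z => b z * xC z i) (f' := fun z => xC z i * b' i z)
      (g := fun z => ‖f z‖ ^ 2) (g' := fun z => 2 * (f z * conj (g i z)).re) (v := eV i)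
      (B := ContinuousLinearMap.mul ℝ ℝ) (i1 i) ?_ ?_ ?_ ?_
    · simpa using key
    · refine ((i2 i).re.const_mul 2).congr (Filter.Eventually.of_forall fun z => ?_)
      simp only [ContinuousLinearMap.mul_apply']
      rw [mul_assoc ((b z * xC z i : ℝ) : ℂ), ← Complex.re_ofReal_mul]
      change 2 * Complex.re _ = _
      rw [Complex.re_ofReal_mul, Complex.re_ofReal_mul]; ring
    · refine i0 (fun z => b z * xC z i) ?_
      have := hb.mul (hx i)
      simpa using this
    · intro z _
      have h1 := hd i z
      unfold HasLineDerivAt at h1 ⊢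
      simp only [xC_add_eV]
      have := h1.mul_const (xC z i)
      rwa [mul_comm] at this
    · intro z _
      have h1 : HasLineDerivAt ℝ f (g i z) z (eV i) :=
        (f.differentiableAt.hasFDerivAt).hasLineDerivAt (eV i)
      unfold HasLineDerivAt at h1 ⊢
      have h2 := h1.norm_sq
      simp only [zero_smul, add_zero] at h2
      have h3 : (2 : ℝ) * (f z * conj (g i z)).re = 2 * inner ℝ (f z) (g i z) := by
        rw [Complex.inner, ← Complex.conj_re]; simp; ring
      rw [h3]
      exact h2
  have e1 : inner ℂ (Xu u) (Sm f (fun z => (b z : ℂ))) = ∫ z, ((b z : ℂ) * f z) * conj ((𝓕 (uX u)) z) := by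
    rw [inner_Sm hb]
    apply integral_congr_ae
    have : (𝓕 (Xu u) : HH (Z n)) = (𝓕 (uX u)).toLp 2 volume := by
      unfold Xu
      rw [SchwartzMap.toLp_fourier_eq]
    rw [this]
    filter_upwards [(𝓕 (uX u)).coeFn_toLp 2 volume] with z hz
    rw [hz]
  rw [e1]
  have i3 : Integrable (fun z => ((b z : ℂ) * f z) * conj ((𝓕 (uX u)) z)) := adm_integrable2 hb f _
  have e2 : (∫ z, ((b z : ℂ) * f z) * conj ((𝓕 (uX u)) z)).re
      = ∫ z, (((b z : ℂ) * f z) * conj ((𝓕 (uX u)) z)).re := (integral_re i3).symm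
  rw [e2]
  have e3 : ∀ z, (((b z : ℂ) * f z) * conj ((𝓕 (uX u)) z)).re
      = ∑ i, (-1 / 2 : ℝ) * ((b z * xC z i) * (2 * (f z * conj (g i z)).re)) := by
    intro z
    rw [fourier_uX, ← hf]
    have hgz : ∀ i, fderiv ℝ f z (eV i) = g i z := fun i => rfl
    simp only [hgz]
    have : ((b z : ℂ) * f z) * conj (2 * π * Complex.I * tC z * f z - ∑ i, (xC z i : ℂ) * g i z)
       = ((- (2 * π * tC z * b z * ‖f z‖ ^ 2) : ℝ) : ℂ) * Complex.I
        + ∑ i, ((- (b z * xC z i) : ℝ) : ℂ) * (f z * conj (g i z)) := by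
      simp only [map_sub, map_mul, map_sum, Complex.conj_ofReal, Complex.conj_I, mul_sub,
        Finset.mul_sum]
      have q := hq (f z)
      rw [sub_eq_add_neg, ← Finset.sum_neg_distrib]
      congr 1
      · push_cast at q ⊢
        rw [← q]
        have : conj (2 : ℂ) = 2 := Complex.conj_ofNat 2
        rw [this]; ring
      · apply Finset.sum_congr rfl
        intro i _
        push_cast; ring
    rw [this, Complex.add_re, Complex.re_ofReal_mul, Complex.I_re, mul_zero, zero_add,
      Complex.re_sum]
    apply Finset.sum_congr rfl
    intro i _
    rw [Complex.re_ofReal_mul]; ring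
  simp only [e3]
  rw [integral_finsetSum]
  · simp only [integral_const_mul, ibp, Finset.sum_mul]
    rw [integral_finsetSum _ (fun i _ => i1 i), Finset.mul_sum]
    apply Finset.sum_congr rfl
    intro i _
    ring
  · intro i _
    apply Integrable.const_mul
    refine ((i2 i).re.const_mul 2).congr (Filter.Eventually.of_forall fun z => ?_)
    simp only [mul_assoc ((b z * xC z i : ℝ) : ℂ)]
    change 2 * Complex.re _ = _
    rw [Complex.re_ofReal_mul]; ring

end Kin

section SRsec

variable {V : Type*} [NormedAddCommGroup V] [InnerProductSpace ℝ V] [FiniteDimensional ℝ V]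
  [MeasurableSpace V] [BorelSpace V]

/-- real admissible symbols -/
def AdmR (m : V → ℝ) : Prop := Adm (fun z => (m z : ℂ))

/-- real multipliers -/
def SR (f : 𝓢(V, ℂ)) (m : V → ℝ) : HH V := Sm f (fun z => (m z : ℂ))

lemma AdmR.mul {m m' : V → ℝ} (h : AdmR m) (h' : AdmR m') : AdmR (fun z => m z * m' z) := by
  have := Adm.mul h h'
  unfold AdmR; simpa using this

lemma AdmR.add {m m' : V → ℝ} (h : AdmR m) (h' : AdmR m') : AdmR (fun z => m z + m' z) := by
  have := Adm.add h h'
  unfold AdmR; simpa using this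

lemma AdmR.sub {m m' : V → ℝ} (h : AdmR m) (h' : AdmR m') : AdmR (fun z => m z - m' z) := by
  have := Adm.sub h h'
  unfold AdmR; simpa using this

lemma AdmR.const (c : ℝ) : AdmR (fun _ : V => c) := Adm.const (c : ℂ)

lemma AdmR.of_le {m m' : V → ℝ} (hm : Measurable m) (h' : AdmR m') (h : ∀ z, |m z| ≤ |m' z|) :
    AdmR m := by
  refine Adm.of_le (Complex.measurable_ofReal.comp hm) h' fun z => ?_
  simpa using h z

lemma AdmR.of_bdd {m : V → ℝ} (hm : Measurable m) (c : ℝ) (h : ∀ z, |m z| ≤ c) : AdmR m := by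
  refine AdmR.of_le hm (AdmR.const c) fun z => (h z).trans (le_abs_self c)

lemma AdmR.rpow {g : V → ℝ} (hm : Measurable g) (h0 : ∀ z, 0 ≤ g z) (h1 : ∀ z, g z ≤ 1 + ‖z‖)
    {r : ℝ} (hr : 0 ≤ r) : AdmR (fun z => g z ^ r) := by
  refine ⟨Complex.measurable_ofReal.comp (by fun_prop), 1, ⌈r⌉₊, fun z => ?_⟩
  rw [Complex.norm_real, Real.norm_of_nonneg (Real.rpow_nonneg (h0 z) r), one_mul]
  calc g z ^ r ≤ (1 + ‖z‖) ^ r := Real.rpow_le_rpow (h0 z) (h1 z) hr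
    _ ≤ (1 + ‖z‖) ^ (⌈r⌉₊ : ℝ) := Real.rpow_le_rpow_of_exponent_le (by simp) (Nat.le_ceil r)
    _ = _ := Real.rpow_natCast _ _

lemma SR_add {f : 𝓢(V, ℂ)} {m m' : V → ℝ} (hm : AdmR m) (hm' : AdmR m') :
    SR f (fun z => m z + m' z) = SR f m + SR f m' := by
  unfold SR
  rw [← Sm_add hm hm']; simp

lemma inner_SR {f : 𝓢(V, ℂ)} {m m' : V → ℝ} (hm : AdmR m) (hm' : AdmR m') :
    Integrable (fun z => m z * m' z * ‖f z‖ ^ 2) ∧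
    inner ℂ (SR f m') (SR f m) = ((∫ z, m z * m' z * ‖f z‖ ^ 2 : ℝ) : ℂ) := by
  have hq : ∀ w : ℂ, (w * conj w) = ((‖w‖ ^ 2 : ℝ) : ℂ) := by
    intro w; rw [Complex.mul_conj, Complex.normSq_eq_norm_sq]
  have e : ∀ z, ((m z : ℂ) * f z) * conj ((m' z : ℂ) * f z) = ((m z * m' z * ‖f z‖ ^ 2 : ℝ) : ℂ) := by
    intro z
    rw [map_mul, Complex.conj_ofReal]
    have := hq (f z)
    push_cast at this ⊢
    rw [← this]; ring
  constructor
  · have := MemLp.integrable_mul (p := 2) (q := 2) (Adm.memLp hm f) (Adm.memLp hm' f).star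
    refine this.re.congr (Filter.Eventually.of_forall fun z => ?_)
    have e' := e z
    change Complex.re (((m z : ℂ) * f z) * conj ((m' z : ℂ) * f z)) = _
    rw [e']; exact Complex.ofReal_re _
  · unfold SR
    rw [inner_Sm_Sm hm hm', ← integral_complex_ofReal]
    simp only [e]

lemma norm_SR_sq {f : 𝓢(V, ℂ)} {m : V → ℝ} (hm : AdmR m) :
    ‖SR f m‖ ^ 2 = ∫ z, m z * m z * ‖f z‖ ^ 2 := by
  have := (inner_SR (f := f) hm hm).2
  rw [inner_self_eq_norm_sq_to_K] at this
  apply Complex.ofReal_injective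
  rw [← this]
  push_cast; rfl

lemma norm_SR_le {f : 𝓢(V, ℂ)} {m m' : V → ℝ} (hm : AdmR m) (hm' : AdmR m') {c : ℝ} (hc : 0 ≤ c)
    (h : ∀ z, |m z| ≤ c * |m' z|) : ‖SR f m‖ ≤ c * ‖SR f m'‖ :=
  norm_Sm_le hm hm' hc (by simpa using h)

lemma SR_interp {f : 𝓢(V, ℂ)} {m m1 m2 : V → ℝ} (hm : AdmR m) (h1 : AdmR m1) (h2 : AdmR m2)
    (h : ∀ z, m z * m z ≤ m1 z * m2 z) : ‖SR f m‖ ^ 2 ≤ ‖SR f m1‖ * ‖SR f m2‖ := by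
  obtain ⟨i, e⟩ := inner_SR (f := f) h2 h1
  have k := norm_inner_le_norm (𝕜 := ℂ) (SR f m1) (SR f m2)
  rw [e, Complex.norm_real] at k
  rw [norm_SR_sq hm]
  refine le_trans ?_ ((le_abs_self _).trans k)
  apply integral_mono (inner_SR (f := f) hm hm).1 i
  intro z
  have := mul_le_mul_of_nonneg_right (h z) (sq_nonneg ‖f z‖)
  simp only
  linarith

variable {EE : Type*} [NormedAddCommGroup EE] [InnerProductSpace ℝ EE] [FiniteDimensional ℝ EE]
  [MeasurableSpace EE] [BorelSpace EE] [Nontrivial EE]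

lemma form_lowerR (ι : EE →L[ℝ] V) (p : V → EE) (hp : ∀ h z, inner ℝ z (ι h) = inner ℝ (p z) h)
    (hpm : Measurable p) {θ : ℝ} (h0 : 0 < θ) (h1 : θ < 2)
    {a : V → ℝ} (ha : BM a) {L : ℝ}
    (hL : ∀ (h : EE) z, |a (z + ι h) - a z| ≤ L * min 1 ‖h‖) {a0 : ℝ} (ha0 : 0 < a0)
    (hlow : ∀ z, a0 ≤ a z) :
    ∃ C : ℝ, 0 ≤ C ∧ ∀ (f : 𝓢(V, ℂ)) (m : V → ℝ), AdmR m →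
      AdmR (fun z => ‖p z‖ ^ θ * m z) → AdmR (fun z => ‖p z‖ ^ (θ / 2) * m z) →
      a0 / 2 * ‖SR f (fun z => ‖p z‖ ^ (θ / 2) * m z)‖ ^ 2 - C * ‖SR f m‖ ^ 2 ≤
      (inner ℂ (Mu a (SR f m)) (SR f (fun z => ‖p z‖ ^ θ * m z))).re := by
  obtain ⟨C, hC, h⟩ := form_lower ι p hp hpm h0 h1 ha hL ha0 hlow
  refine ⟨C, hC, fun f m k1 k2 k3 => ?_⟩
  unfold AdmR at k1 k2 k3
  unfold SR
  simp only [Complex.ofReal_mul] at k1 k2 k3 ⊢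
  exact h f _ k1 k2 k3

lemma form_upperR (ι : EE →L[ℝ] V) (p : V → EE) (hp : ∀ h z, inner ℝ z (ι h) = inner ℝ (p z) h)
    (hpm : Measurable p) {θ : ℝ} (h0 : 0 < θ) (h1 : θ < 2)
    {a : V → ℝ} (ha : BM a) {L : ℝ}
    (hL : ∀ (h : EE) z, |a (z + ι h) - a z| ≤ L * min 1 ‖h‖) {K : ℝ}
    (hK : ∀ z, |a z| ≤ K) :
    ∃ C : ℝ, 0 ≤ C ∧ ∀ (f : 𝓢(V, ℂ)) (m m' : V → ℝ), AdmR m →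
      AdmR (fun z => ‖p z‖ ^ θ * m z) → AdmR (fun z => ‖p z‖ ^ (θ / 2) * m z) → AdmR m' →
      AdmR (fun z => ‖p z‖ ^ θ * m' z) → AdmR (fun z => ‖p z‖ ^ (θ / 2) * m' z) →
      ‖inner ℂ (Mu a (SR f m')) (SR f (fun z => ‖p z‖ ^ θ * m z))‖ ≤
       C * (‖SR f (fun z => ‖p z‖ ^ (θ / 2) * m z)‖ ^ 2
        + ‖SR f (fun z => ‖p z‖ ^ (θ / 2) * m' z)‖ ^ 2 + ‖SR f m'‖ ^ 2) := by
  obtain ⟨C, hC, h⟩ := form_upper ι p hp hpm h0 h1 ha hL hK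
  refine ⟨C, hC, fun f m m' k1 k2 k3 l1 l2 l3 => ?_⟩
  unfold AdmR at k1 k2 k3 l1 l2 l3
  unfold SR
  simp only [Complex.ofReal_mul] at k1 k2 k3 l1 l2 l3 ⊢
  exact h f _ _ k1 k2 k3 l1 l2 l3

lemma commutR (ι : EE →L[ℝ] V) (p : V → EE) (hp : ∀ h z, inner ℝ z (ι h) = inner ℝ (p z) h)
    (hpm : Measurable p) {θ : ℝ} (h0 : 0 < θ) (h1 : θ < 1)
    {a : V → ℝ} (ha : BM a) {L : ℝ}
    (hL : ∀ (h : EE) z, |a (z + ι h) - a z| ≤ L * min 1 ‖h‖) :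
    ∃ C : ℝ, 0 ≤ C ∧ ∀ (f : 𝓢(V, ℂ)) (m m' : V → ℝ), AdmR m →
      AdmR (fun z => ‖p z‖ ^ θ * m z) → AdmR m' → AdmR (fun z => ‖p z‖ ^ θ * m' z) →
      ‖inner ℂ (Mu a (SR f m)) (SR f (fun z => ‖p z‖ ^ θ * m' z)) -
        conj (inner ℂ (Mu a (SR f m')) (SR f (fun z => ‖p z‖ ^ θ * m z)))‖ ≤
       C * ‖SR f m‖ * ‖SR f m'‖ := by
  obtain ⟨C, hC, h⟩ := commut ι p hp hpm h0 h1 ha hL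
  refine ⟨C, hC, fun f m m' k1 k2 l1 l2 => ?_⟩
  unfold AdmR at k1 k2 l1 l2
  unfold SR
  simp only [Complex.ofReal_mul] at k1 k2 l1 l2 ⊢
  exact h f _ _ k1 k2 l1 l2

end SRsec

section Scalar

lemma scal_b1_upper {σ e s : ℝ} (h0 : 0 < σ) (h1 : σ < 1) (he : 0 ≤ e) (hs : 1 ≤ s) :
    e ^ (2 * σ) ≤ (e ^ 2 + s ^ 2) ^ σ ∧ (e ^ 2 + s ^ 2) ^ σ ≤ e ^ (2 * σ) + s ^ (2 * σ) := by
  have e1 : e ^ (2 * σ) = (e ^ 2) ^ σ := by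
    rw [← Real.rpow_natCast, ← Real.rpow_mul he]; norm_num
  have e2 : s ^ (2 * σ) = (s ^ 2) ^ σ := by
    rw [← Real.rpow_natCast, ← Real.rpow_mul (by linarith)]; norm_num
  rw [e1, e2]
  refine ⟨Real.rpow_le_rpow (by positivity) (by nlinarith) h0.le, ?_⟩
  exact Real.rpow_add_le_add_rpow (by positivity) (by positivity) h0.le h1.le

lemma scal_b1_deriv {σ e s x t : ℝ} (h0 : 0 < σ) (h1 : σ < 1) (he : 0 ≤ e) (hs : 1 ≤ s)
    (hx : x ≤ s ^ (2 * σ + 1)) (hx0 : 0 ≤ x) (ht : |t| ≤ x * e) :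
    |2 * σ * (e ^ 2 + s ^ 2) ^ (σ - 1) * t| ≤ (e ^ (2 * σ) + s ^ (2 * σ)) * s ^ (2 * σ) := by
  have hs0 : 0 < s := by linarith
  have hp : 0 < e ^ 2 + s ^ 2 := by positivity
  have hq : 0 < (e ^ 2 + s ^ 2) ^ (σ - 1) := Real.rpow_pos_of_pos hp _
  rw [abs_mul, abs_of_nonneg (by positivity)]
  have e1 : s ^ (2 * σ + 1) = s ^ (2 * σ) * s := by
    rw [Real.rpow_add hs0, Real.rpow_one]
  have hS : 0 < s ^ (2 * σ) := Real.rpow_pos_of_pos hs0 _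
  have e2 : (e ^ 2 + s ^ 2) ^ (σ - 1) * (e ^ 2 + s ^ 2) = (e ^ 2 + s ^ 2) ^ σ := by
    rw [Real.rpow_sub_one hp.ne']; field_simp
  have k1 : |t| ≤ s ^ (2 * σ) * ((e ^ 2 + s ^ 2) / 2) := by
    calc |t| ≤ x * e := ht
      _ ≤ s ^ (2 * σ + 1) * e := by gcongr
      _ = s ^ (2 * σ) * (s * e) := by rw [e1]; ring
      _ ≤ _ := by gcongr; nlinarith [sq_nonneg (s - e)]
  calc 2 * σ * (e ^ 2 + s ^ 2) ^ (σ - 1) * |t|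
      ≤ 2 * 1 * (e ^ 2 + s ^ 2) ^ (σ - 1) * (s ^ (2 * σ) * ((e ^ 2 + s ^ 2) / 2)) := by gcongr
    _ = ((e ^ 2 + s ^ 2) ^ (σ - 1) * (e ^ 2 + s ^ 2)) * s ^ (2 * σ) := by ring
    _ ≤ _ := by
      rw [e2]
      gcongr
      exact (scal_b1_upper h0 h1 he hs).2

lemma scal_b2 {σ e s x M y : ℝ} (h0 : 0 < σ) (he : 0 ≤ e) (hs : 1 ≤ s)
    (hM : M = max 1 x) (hsM : s ^ (2 * σ + 1) = M) (hx0 : 0 ≤ x) (hy : |y| ≤ e / s) :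
    s ^ (2 * σ) * s ^ (2 * σ) ≤ 2 * (s ^ (2 * σ) * (1 / (1 + y ^ 2) * (x ^ 2 / (M * s))))
      + e ^ (2 * σ) * s ^ (2 * σ) + s ^ (2 * σ) := by
  have hs0 : 0 < s := by linarith
  have e1 : s ^ (2 * σ + 1) = s ^ (2 * σ) * s := by
    rw [Real.rpow_add hs0, Real.rpow_one]
  have hS : 1 ≤ s ^ (2 * σ) := Real.one_le_rpow hs (by positivity)
  have hM1 : 1 ≤ M := by rw [hM]; exact le_max_left _ _
  have hE : 0 ≤ e ^ (2 * σ) := by positivity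
  set S := s ^ (2 * σ) with hSdef
  have hnn : 0 ≤ 1 / (1 + y ^ 2) * (x ^ 2 / (M * s)) := by positivity
  rcases le_total x 1 with hx | hx
  · have : M = 1 := by rw [hM]; exact max_eq_left hx
    rw [e1, this] at hsM
    have hS1 : S ≤ 1 := by nlinarith
    have hS2 : S = 1 := le_antisymm hS1 hS
    rw [hS2]
    linarith
  · have : M = x := by rw [hM]; exact max_eq_right hx
    have q : x ^ 2 / (M * s) = S := by
      rw [this]; rw [this] at hsM
      rw [← hsM, e1]; field_simp
    rw [q]
    rcases le_total (y ^ 2) 1 with h | h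
    · have : 1 / 2 ≤ 1 / (1 + y ^ 2) := by
        apply one_div_le_one_div_of_le (by positivity); linarith
      have : S * S ≤ 2 * (S * (1 / (1 + y ^ 2) * S)) := by
        have hh : 0 ≤ S * S := by positivity
        nlinarith
      have : 0 ≤ e ^ (2 * σ) * S := by positivity
      linarith
    · have h1 : 1 ≤ |y| := by
        by_contra hc
        push Not at hc
        have : |y| ^ 2 < 1 := by nlinarith [abs_nonneg y]
        rw [sq_abs] at this; linarith
      have h2 : s ≤ e := by
        have := h1.trans hy
        rwa [le_div_iff₀ hs0, one_mul] at this
      have h3 : S ≤ e ^ (2 * σ) := Real.rpow_le_rpow hs0.le h2 (by positivity)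
      have h4 : 0 ≤ 2 * (S * (1 / (1 + y ^ 2) * S)) := by positivity
      nlinarith

lemma scal_F {σ e w : ℝ} (h0 : 0 < σ) (h1 : σ < 1) (he : 0 ≤ e) (hw0 : 0 ≤ w) (hw1 : w ≤ 1)
    (hw2 : 2 ≤ e → w = 1) :
    |e ^ (2 * σ) * w + e ^ 2 * (1 - w) - e ^ (2 * σ)| ≤ 4 := by
  have : e ^ (2 * σ) * w + e ^ 2 * (1 - w) - e ^ (2 * σ) = (e ^ 2 - e ^ (2 * σ)) * (1 - w) := by ring
  rw [this]
  rcases le_total 2 e with h | h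
  · rw [hw2 h]; norm_num
  · rw [abs_mul, abs_of_nonneg (by linarith : 0 ≤ 1 - w)]
    have k1 : e ^ 2 ≤ 4 := by nlinarith
    have k2 : e ^ (2 * σ) ≤ 4 := by
      rcases le_total e 1 with h' | h'
      · have := Real.rpow_le_one he h' (by positivity : 0 ≤ 2 * σ); linarith
      · have := Real.rpow_le_rpow_of_exponent_le h' (by push_cast; linarith : 2 * σ ≤ ((2 : ℕ) : ℝ))
        rw [Real.rpow_natCast] at this; linarith
    have k3 : |e ^ 2 - e ^ (2 * σ)| ≤ 4 := by
      rw [abs_le]; constructor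
      · nlinarith [sq_nonneg e]
      · have : 0 ≤ e ^ (2 * σ) := by positivity
        linarith
    nlinarith [abs_nonneg (e ^ 2 - e ^ (2 * σ))]

lemma scal_S1 {θ x : ℝ} (h0 : 0 < θ) (hx : 0 ≤ x) :
    |(max 1 x) ^ θ - x ^ θ| ≤ 1 := by
  rcases le_total x 1 with h | h
  · rw [max_eq_left h, Real.one_rpow, abs_le]
    have := Real.rpow_le_one hx h h0.le
    have : 0 ≤ x ^ θ := by positivity
    constructor <;> linarith
  · rw [max_eq_right h]; simp

/-- final real algebra, step 1 -/
lemma alg1 {a0 c X T : ℝ} (ha0 : 0 < a0) (hc : 0 ≤ c) (hX : 0 ≤ X) (hT : 0 ≤ T)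
    (h : a0 * X ^ 2 ≤ c * (X * T + T ^ 2)) : X ≤ (2 * c / a0 + 1) * T := by
  have hq : 0 ≤ 2 * c / a0 := by positivity
  rcases le_total X T with h1 | h1
  · nlinarith
  · rcases eq_or_lt_of_le hX with h2 | h2
    · rw [← h2]; positivity
    · have : a0 * X ^ 2 ≤ c * (2 * X * T) := h.trans (by gcongr; nlinarith)
      have k : a0 * X ≤ 2 * c * T := by
        have : X * (a0 * X) ≤ X * (2 * c * T) := by linarith
        exact le_of_mul_le_mul_left this h2
      have k2 : X ≤ 2 * c / a0 * T := by
        rw [div_mul_eq_mul_div, le_div_iff₀ ha0]; linarith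
      linarith

/-- final real algebra, step 2 -/
lemma alg2 {C C1 D X Y R : ℝ} (hC : 0 ≤ C) (hC1 : 0 ≤ C1) (hD : 0 ≤ D) (hY : 0 ≤ Y) (hR : 0 ≤ R)
    (hRY : R ^ 2 ≤ D * Y) (hX : X ≤ C1 * (D + Y)) (h : Y ^ 2 ≤ C * (D * Y + X * R)) :
    Y ≤ (2 * C + (2 * C * C1) ^ 2 + 1) * D := by
  rcases le_total Y D with h1 | h1
  · have : 0 ≤ (2 * C + (2 * C * C1) ^ 2) * D := by positivity
    linarith
  · rcases eq_or_lt_of_le hY with h2 | h2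
    · rw [← h2]; positivity
    · have hX2 : X ≤ 2 * C1 * Y := by nlinarith
      set k := 2 * C * C1 with hk
      have hk0 : 0 ≤ k := by positivity
      have k1 : Y ≤ C * D + k * R := by
        have : Y * Y ≤ Y * (C * D + k * R) := by
          have : X * R ≤ 2 * C1 * Y * R := by gcongr
          have := mul_le_mul_of_nonneg_left this hC
          rw [hk]; nlinarith
        exact le_of_mul_le_mul_left this h2
      have k2 : k * R ≤ (k ^ 2 * D + Y) / 2 := by
        apply le_of_sq_le_sq _ (by positivity)
        have : (k * R) ^ 2 ≤ k ^ 2 * (D * Y) := by rw [mul_pow]; gcongr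
        nlinarith [sq_nonneg (k ^ 2 * D - Y)]
      nlinarith

end Scalar

section Symb

/-- `max(1,|ξ|)` -/
def MX (z : Z n) : ℝ := max 1 ‖xC z‖
/-- `max(1,|ξ|)^{1/(2σ+1)}` -/
def ss (σ : ℝ) (z : Z n) : ℝ := MX z ^ (1 / (2 * σ + 1))
/-- the angle variable -/
def yy (σ : ℝ) (z : Z n) : ℝ := inner ℝ (xC z) (vC z) / (MX z * ss σ z)
/-- the bounded symbol -/
def GG (σ : ℝ) (z : Z n) : ℝ := Real.arctan (yy σ z)
/-- first symbol -/
def b1 (σ : ℝ) (z : Z n) : ℝ := (‖vC z‖ ^ 2 + ss σ z ^ 2) ^ σ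
/-- second symbol -/
def b2 (σ : ℝ) (z : Z n) : ℝ := ss σ z ^ (2 * σ) * GG σ z

lemma one_le_MX (z : Z n) : 1 ≤ MX z := le_max_left _ _

lemma MX_le (z : Z n) : MX z ≤ 1 + ‖z‖ :=
  max_le (by simp) ((norm_xC_le z).trans (by simp))

lemma one_le_ss {σ : ℝ} (h0 : 0 < σ) (z : Z n) : 1 ≤ ss σ z :=
  Real.one_le_rpow (one_le_MX z) (by positivity)

lemma ss_pow {σ : ℝ} (h0 : 0 < σ) (z : Z n) : ss σ z ^ (2 * σ + 1) = MX z := by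
  unfold ss
  rw [← Real.rpow_mul (by linarith [one_le_MX z]), one_div, inv_mul_cancel₀ (by positivity),
    Real.rpow_one]

lemma ss_sig {σ : ℝ} (h0 : 0 < σ) (z : Z n) : ss σ z ^ σ = MX z ^ (σ / (2 * σ + 1)) := by
  unfold ss
  rw [← Real.rpow_mul (by linarith [one_le_MX z])]
  congr 1; ring

lemma ss_le {σ : ℝ} (h0 : 0 < σ) (z : Z n) : ss σ z ≤ MX z := by
  unfold ss
  conv_rhs => rw [← Real.rpow_one (MX z)]
  apply Real.rpow_le_rpow_of_exponent_le (one_le_MX z)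
  rw [div_le_one (by positivity)]; linarith

lemma cont_MX : Continuous (MX : Z n → ℝ) := by
  unfold MX; fun_prop

lemma meas_MX : Measurable (MX : Z n → ℝ) := cont_MX.measurable

lemma meas_ss (σ : ℝ) : Measurable (ss σ : Z n → ℝ) := by
  have := meas_MX (n := n)
  unfold ss; fun_prop

lemma meas_yy (σ : ℝ) : Measurable (yy σ : Z n → ℝ) := by
  have := meas_MX (n := n)
  have := meas_ss (n := n) σ
  unfold yy; fun_prop

lemma meas_GG (σ : ℝ) : Measurable (GG σ : Z n → ℝ) := by
  have := meas_yy (n := n) σ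
  unfold GG; fun_prop

lemma meas_b1 (σ : ℝ) : Measurable (b1 σ : Z n → ℝ) := by
  have := meas_ss (n := n) σ
  unfold b1; fun_prop

lemma GG_le (σ : ℝ) (z : Z n) : |GG σ z| ≤ 2 := by
  unfold GG
  have h1 := Real.arctan_lt_pi_div_two (yy σ z)
  have h2 := Real.neg_pi_div_two_lt_arctan (yy σ z)
  have h3 := Real.pi_le_four
  rw [abs_le]; constructor <;> linarith

lemma adm_ss {σ r : ℝ} (h0 : 0 < σ) (hr : 0 ≤ r) : AdmR (fun z : Z n => ss σ z ^ r) :=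
  AdmR.rpow (meas_ss σ) (fun z => by linarith [one_le_ss h0 z])
    (fun z => (ss_le h0 z).trans (MX_le z)) hr

lemma adm_x {r : ℝ} (hr : 0 ≤ r) : AdmR (fun z : Z n => ‖xC z‖ ^ r) :=
  AdmR.rpow (by fun_prop) (fun z => norm_nonneg _) (fun z => (norm_xC_le z).trans (by simp)) hr

lemma adm_v {r : ℝ} (hr : 0 ≤ r) : AdmR (fun z : Z n => ‖vC z‖ ^ r) :=
  AdmR.rpow (by fun_prop) (fun z => norm_nonneg _) (fun z => (norm_vC_le z).trans (by simp)) hr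

lemma adm_xi (i : Fin n) : AdmR (fun z : Z n => xC z i) := by
  refine AdmR.of_le (by fun_prop) (adm_x (r := 1) (by norm_num)) fun z => ?_
  rw [Real.rpow_one, abs_of_nonneg (norm_nonneg _)]
  exact PiLp.norm_apply_le (xC z) i

lemma adm_vi (i : Fin n) : AdmR (fun z : Z n => vC z i) := by
  refine AdmR.of_le (by fun_prop) (adm_v (r := 1) (by norm_num)) fun z => ?_
  rw [Real.rpow_one, abs_of_nonneg (norm_nonneg _)]
  exact PiLp.norm_apply_le (vC z) i

lemma adm_GG (σ : ℝ) : AdmR (GG σ : Z n → ℝ) := AdmR.of_bdd (meas_GG σ) 2 (GG_le σ)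

lemma b1_bounds {σ : ℝ} (h0 : 0 < σ) (h1 : σ < 1) (z : Z n) :
    |b1 σ z - ‖vC z‖ ^ (2 * σ)| ≤ ss σ z ^ (2 * σ) := by
  have h := scal_b1_upper h0 h1 (norm_nonneg (vC z)) (one_le_ss h0 z)
  unfold b1
  rw [abs_le]; constructor
  · have : 0 ≤ ss σ z ^ (2 * σ) := Real.rpow_nonneg (by linarith [one_le_ss h0 z]) _
    linarith [h.1]
  · linarith [h.2]

lemma adm_b1 {σ : ℝ} (h0 : 0 < σ) (h1 : σ < 1) : AdmR (b1 σ : Z n → ℝ) := by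
  refine AdmR.of_le (meas_b1 σ) ((adm_v (r := 2 * σ) (by positivity)).add
    (adm_ss (r := 2 * σ) h0 (by positivity))) fun z => ?_
  have h := scal_b1_upper h0 h1 (norm_nonneg (vC z)) (one_le_ss h0 z)
  have hb : 0 ≤ b1 σ z := by unfold b1; positivity
  rw [abs_of_nonneg hb]
  exact h.2.trans (le_abs_self _)

lemma adm_b2 {σ : ℝ} (h0 : 0 < σ) : AdmR (b2 σ : Z n → ℝ) :=
  (adm_ss h0 (by positivity)).mul (adm_GG σ)

lemma ss_add_eV (σ : ℝ) (z : Z n) (i : Fin n) (t : ℝ) : ss σ (z + t • eV i) = ss σ z := by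
  unfold ss MX; rw [xC_add_eV]

lemma MX_add_eV (z : Z n) (i : Fin n) (t : ℝ) : MX (z + t • eV i) = MX z := by
  unfold MX; rw [xC_add_eV]

lemma deriv_vline (z : Z n) (i : Fin n) :
    HasDerivAt (fun t : ℝ => vC z + t • (EuclideanSpace.single i 1 : E n))
      (EuclideanSpace.single i 1) 0 := by
  have := ((hasDerivAt_id (0 : ℝ)).smul_const (EuclideanSpace.single i 1 : E n)).const_add (vC z)
  simpa using this

lemma b1_deriv {σ : ℝ} (h0 : 0 < σ) (i : Fin n) (z : Z n) :
    HasLineDerivAt ℝ (b1 σ) (2 * vC z i * σ * (‖vC z‖ ^ 2 + ss σ z ^ 2) ^ (σ - 1)) z (eV i) := by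
  unfold HasLineDerivAt b1
  simp only [ss_add_eV, vC_add_eV]
  have h := ((deriv_vline z i).norm_sq.add_const (ss σ z ^ 2)).rpow_const (p := σ) (Or.inl ?_)
  · simp only [zero_smul, add_zero, EuclideanSpace.inner_single_right] at h
    simpa using h
  · have := one_le_ss h0 z
    positivity

lemma b2_deriv {σ : ℝ} (i : Fin n) (z : Z n) :
    HasLineDerivAt ℝ (b2 σ)
      (ss σ z ^ (2 * σ) * (1 / (1 + yy σ z ^ 2) * (xC z i / (MX z * ss σ z)))) z (eV i) := by
  unfold HasLineDerivAt b2 GG yy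
  simp only [ss_add_eV, vC_add_eV, xC_add_eV, MX_add_eV]
  have h1 : HasDerivAt (fun t : ℝ => inner ℝ (xC z) (vC z + t • (EuclideanSpace.single i 1 : E n)))
      (xC z i) 0 := by
    have := (hasDerivAt_const (0 : ℝ) (xC z)).inner ℝ (deriv_vline z i)
    simpa [EuclideanSpace.inner_single_right] using this
  have h := ((h1.div_const (MX z * ss σ z)).arctan).const_mul (ss σ z ^ (2 * σ))
  simpa using h

lemma adm_b1' {σ : ℝ} (h0 : 0 < σ) (h1 : σ < 1) (i : Fin n) :
    AdmR (fun z : Z n => 2 * vC z i * σ * (‖vC z‖ ^ 2 + ss σ z ^ 2) ^ (σ - 1)) := by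
  refine (((AdmR.const 2).mul (adm_vi i)).mul (AdmR.const σ)).mul (AdmR.of_bdd ?_ 1 fun z => ?_)
  · have := meas_ss (n := n) σ
    fun_prop
  · have := one_le_ss h0 z
    rw [abs_of_nonneg (by positivity)]
    apply Real.rpow_le_one_of_one_le_of_nonpos _ (by linarith)
    nlinarith [sq_nonneg ‖vC z‖]

lemma adm_b2' {σ : ℝ} (h0 : 0 < σ) (i : Fin n) :
    AdmR (fun z : Z n => ss σ z ^ (2 * σ) * (1 / (1 + yy σ z ^ 2) * (xC z i / (MX z * ss σ z)))) := by
  have := meas_ss (n := n) σ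
  have := meas_MX (n := n)
  have := meas_yy (n := n) σ
  refine (adm_ss h0 (by positivity)).mul ((AdmR.of_bdd (by fun_prop) 1 fun z => ?_).mul
    (AdmR.of_le (by fun_prop) (adm_xi i) fun z => ?_))
  · rw [abs_of_nonneg (by positivity), div_le_one (by positivity)]
    nlinarith [sq_nonneg (yy σ z)]
  · have h1 := one_le_ss h0 z
    have h2 := one_le_MX z
    rw [abs_div, abs_of_nonneg (by positivity : 0 ≤ MX z * ss σ z)]
    apply div_le_self (abs_nonneg _)
    nlinarith

lemma sum_xv (z : Z n) : ∑ i, xC z i * vC z i = inner ℝ (xC z) (vC z) := by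
  rw [PiLp.inner_apply]
  apply Finset.sum_congr rfl
  intro i _
  simp [mul_comm]

lemma sum_xx (z : Z n) : ∑ i, xC z i * xC z i = ‖xC z‖ ^ 2 := by
  rw [← real_inner_self_eq_norm_sq, PiLp.inner_apply]
  apply Finset.sum_congr rfl
  intro i _
  simp [pow_two]

lemma b1_main {σ : ℝ} (h0 : 0 < σ) (h1 : σ < 1) (z : Z n) :
    |∑ i, xC z i * (2 * vC z i * σ * (‖vC z‖ ^ 2 + ss σ z ^ 2) ^ (σ - 1))| ≤
      (‖vC z‖ ^ (2 * σ) + ss σ z ^ (2 * σ)) * ss σ z ^ (2 * σ) := by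
  have e : ∑ i, xC z i * (2 * vC z i * σ * (‖vC z‖ ^ 2 + ss σ z ^ 2) ^ (σ - 1))
    = 2 * σ * (‖vC z‖ ^ 2 + ss σ z ^ 2) ^ (σ - 1) * inner ℝ (xC z) (vC z) := by
    rw [← sum_xv, Finset.mul_sum]
    apply Finset.sum_congr rfl
    intro i _; ring
  rw [e]
  apply scal_b1_deriv h0 h1 (norm_nonneg _) (one_le_ss h0 z) _ (norm_nonneg (xC z))
    (abs_real_inner_le_norm _ _)
  rw [ss_pow h0]; exact le_max_right _ _

lemma b2_main {σ : ℝ} (h0 : 0 < σ) (z : Z n) :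
    ss σ z ^ (2 * σ) * ss σ z ^ (2 * σ) ≤
     2 * (∑ i, xC z i * (ss σ z ^ (2 * σ) * (1 / (1 + yy σ z ^ 2) * (xC z i / (MX z * ss σ z)))))
      + ‖vC z‖ ^ (2 * σ) * ss σ z ^ (2 * σ) + ss σ z ^ (2 * σ) := by
  have e : ∑ i, xC z i * (ss σ z ^ (2 * σ) * (1 / (1 + yy σ z ^ 2) * (xC z i / (MX z * ss σ z))))
    = ss σ z ^ (2 * σ) * (1 / (1 + yy σ z ^ 2) * (‖xC z‖ ^ 2 / (MX z * ss σ z))) := by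
    rw [← sum_xx, Finset.sum_div, Finset.mul_sum, Finset.mul_sum]
    apply Finset.sum_congr rfl
    intro i _; ring
  rw [e]
  apply scal_b2 h0 (norm_nonneg _) (one_le_ss h0 z) rfl (ss_pow h0 z) (norm_nonneg _)
  have h1 := one_le_ss h0 z
  have h2 := one_le_MX z
  unfold yy
  rw [abs_div, abs_of_nonneg (by positivity : 0 ≤ MX z * ss σ z), div_le_div_iff₀ (by positivity)
    (by positivity)]
  have h3 := abs_real_inner_le_norm (xC z) (vC z)
  have h4 : ‖xC z‖ ≤ MX z := le_max_right _ _
  calc |inner ℝ (xC z) (vC z)| * ss σ z ≤ (MX z * ‖vC z‖) * ss σ z := by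
        gcongr; exact h3.trans (by gcongr)
    _ = _ := by ring

end Symb

section Est

lemma en_gen {V : Type*} [NormedAddCommGroup V] [InnerProductSpace ℝ V] [FiniteDimensional ℝ V]
    [MeasurableSpace V] [BorelSpace V] {a : V → ℝ} (ha : BM a) {K : ℝ} (hK : ∀ z, |a z| ≤ K)
    {W X0 A0 V0 B : HH V} {N : ℝ} (hW : W = X0 + Mu a A0 + Mu a V0) (hV : ‖V0‖ ≤ 4 * N)
    (hK0 : 0 ≤ K) (hN : 0 ≤ N) :
    |(inner ℂ (Mu a A0) B).re + (inner ℂ X0 B).re| ≤ (‖W‖ + 4 * K * N + N) * ‖B‖ := by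
  have e : (inner ℂ (Mu a A0) B).re + (inner ℂ X0 B).re
      = (inner ℂ W B).re - (inner ℂ (Mu a V0) B).re := by
    rw [hW, inner_add_left, inner_add_left]
    simp; ring
  rw [e]
  have h1 : |(inner ℂ W B).re| ≤ ‖W‖ * ‖B‖ :=
    (Complex.abs_re_le_norm _).trans (norm_inner_le_norm _ _)
  have h2 : |(inner ℂ (Mu a V0) B).re| ≤ (K * (4 * N)) * ‖B‖ := by
    refine (Complex.abs_re_le_norm _).trans ((norm_inner_le_norm _ _).trans ?_)
    gcongr
    refine (Mu_norm_le ha hK V0).trans ?_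
    gcongr
  have h3 := abs_sub (inner ℂ W B).re (inner ℂ (Mu a V0) B).re
  have h4 : 0 ≤ N * ‖B‖ := by positivity
  nlinarith [abs_sub_le (inner ℂ W B).re 0 (inner ℂ (Mu a V0) B).re, abs_neg (inner ℂ (Mu a V0) B).re, zero_sub (inner ℂ (Mu a V0) B).re, sub_zero (inner ℂ W B).re]

lemma inner_Mu_le {V : Type*} [NormedAddCommGroup V] [InnerProductSpace ℝ V] [FiniteDimensional ℝ V]
    [MeasurableSpace V] [BorelSpace V] {a : V → ℝ} (ha : BM a) {K : ℝ} (hK : ∀ z, |a z| ≤ K)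
    (hK0 : 0 ≤ K) (A B : HH V) : ‖inner ℂ (Mu a A) B‖ ≤ K * ‖A‖ * ‖B‖ := by
  refine (norm_inner_le_norm _ _).trans ?_
  gcongr
  exact Mu_norm_le ha hK A

/-- symbols -/
def sA (σ : ℝ) (z : Z n) : ℝ := ‖vC z‖ ^ (2 * σ)
/-- symbols -/
def s1 (σ : ℝ) (z : Z n) : ℝ := ss σ z ^ σ
/-- symbols -/
def s2 (σ : ℝ) (z : Z n) : ℝ := ss σ z ^ (2 * σ)
/-- symbols -/
def sQ (σ : ℝ) (z : Z n) : ℝ := ‖vC z‖ ^ (2 * σ / 2) * s1 σ z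

lemma adm_sA {σ : ℝ} (h0 : 0 < σ) : AdmR (sA σ : Z n → ℝ) := adm_v (by positivity)
lemma adm_s1 {σ : ℝ} (h0 : 0 < σ) : AdmR (s1 σ : Z n → ℝ) := adm_ss h0 (by positivity)
lemma adm_s2 {σ : ℝ} (h0 : 0 < σ) : AdmR (s2 σ : Z n → ℝ) := adm_ss h0 (by positivity)
lemma adm_sQ {σ : ℝ} (h0 : 0 < σ) : AdmR (sQ σ : Z n → ℝ) := (adm_v (by positivity)).mul (adm_s1 h0)

lemma s1_nonneg {σ : ℝ} (h0 : 0 < σ) (z : Z n) : 0 ≤ s1 σ z :=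
  Real.rpow_nonneg (by linarith [one_le_ss h0 z]) _
lemma s2_nonneg {σ : ℝ} (h0 : 0 < σ) (z : Z n) : 0 ≤ s2 σ z :=
  Real.rpow_nonneg (by linarith [one_le_ss h0 z]) _
lemma sA_nonneg {σ : ℝ} (z : Z n) : 0 ≤ sA σ z := Real.rpow_nonneg (norm_nonneg _) _

lemma s1_sq {σ : ℝ} (h0 : 0 < σ) (z : Z n) : s1 σ z * s1 σ z = s2 σ z := by
  unfold s1 s2
  rw [← Real.rpow_add (by linarith [one_le_ss h0 z])]; congr 1; ring

lemma sQ_sq {σ : ℝ} (h0 : 0 < σ) (z : Z n) : sQ σ z * sQ σ z = sA σ z * s2 σ z := by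
  rw [← s1_sq h0]
  unfold sQ sA
  have : ‖vC z‖ ^ (2 * σ) = ‖vC z‖ ^ (2 * σ / 2) * ‖vC z‖ ^ (2 * σ / 2) := by
    rw [← Real.rpow_add_of_nonneg (norm_nonneg _) (by positivity) (by positivity)]
    congr 1; ring
  rw [this]; ring

lemma est_R {σ : ℝ} (h0 : 0 < σ) (f : 𝓢(Z n, ℂ)) :
    ‖SR f (s1 σ)‖ ^ 2 ≤ ‖SR f (fun _ => 1)‖ * ‖SR f (s2 σ)‖ :=
  SR_interp (adm_s1 h0) (AdmR.const 1) (adm_s2 h0) fun z => by rw [s1_sq h0, one_mul]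

lemma est_Q {σ : ℝ} (h0 : 0 < σ) (f : 𝓢(Z n, ℂ)) :
    ‖SR f (sQ σ)‖ ^ 2 ≤ ‖SR f (sA σ)‖ * ‖SR f (s2 σ)‖ :=
  SR_interp (adm_sQ h0) (adm_sA h0) (adm_s2 h0) fun z => by rw [sQ_sq h0]

lemma est1 {σ : ℝ} (h0 : 0 < σ) (h1 : σ < 1) {a : Z n → ℝ} (ha : BM a) {K : ℝ}
    (hK : ∀ z, |a z| ≤ K) (hK0 : 0 ≤ K) {a0 : ℝ} (ha0 : 0 < a0) (hlow : ∀ z, a0 ≤ a z)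
    (u : 𝓢(Z n, ℂ)) {D : ℝ} (hD : 0 ≤ D)
    (hen : ∀ B, |(inner ℂ (Mu a (SR (𝓕 u) (sA σ))) B).re + (inner ℂ (Xu u) B).re| ≤ D * ‖B‖) :
    ‖SR (𝓕 u) (sA σ)‖ ≤ (2 * (K + 1) / a0 + 1) * (D + ‖SR (𝓕 u) (s2 σ)‖) := by
  set f := 𝓕 u
  set X := ‖SR f (sA σ)‖ with hX
  set Y := ‖SR f (s2 σ)‖ with hY
  have X0 : 0 ≤ X := norm_nonneg _
  have Y0 : 0 ≤ Y := norm_nonneg _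
  have hA := adm_sA (n := n) h0
  have hS := adm_s2 (n := n) h0
  have hb := adm_b1 (n := n) h0 h1
  have hr : AdmR (fun z : Z n => b1 σ z - sA σ z) := hb.sub hA
  have hrn : ‖SR f (fun z => b1 σ z - sA σ z)‖ ≤ Y := by
    have := norm_SR_le (f := f) hr hS (c := 1) (by norm_num) fun z => by
      rw [one_mul, abs_of_nonneg (s2_nonneg h0 z)]; exact b1_bounds h0 h1 z
    simpa using this
  have eb : SR f (b1 σ) = SR f (sA σ) + SR f (fun z => b1 σ z - sA σ z) := by
    rw [← SR_add hA hr]; congr 1; ext z; ring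
  have nb : ‖SR f (b1 σ)‖ ≤ X + Y := by
    rw [eb]; exact (norm_add_le _ _).trans (by linarith)
  have k1 : a0 * X ^ 2 ≤ (inner ℂ (Mu a (SR f (sA σ))) (SR f (sA σ))).re := by
    rw [Mu_symm ha]; exact Mu_lower ha hlow _
  have k2 : |(inner ℂ (Mu a (SR f (sA σ))) (SR f (fun z => b1 σ z - sA σ z))).re| ≤ K * X * Y := by
    refine (Complex.abs_re_le_norm _).trans ((inner_Mu_le ha hK hK0 _ _).trans ?_)
    gcongr
  have k3 : (inner ℂ (Mu a (SR f (sA σ))) (SR f (b1 σ))).re =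
      (inner ℂ (Mu a (SR f (sA σ))) (SR f (sA σ))).re +
      (inner ℂ (Mu a (SR f (sA σ))) (SR f (fun z => b1 σ z - sA σ z))).re := by
    rw [eb, inner_add_right, Complex.add_re]
  have k4 := hen (SR f (b1 σ))
  obtain ⟨i1, t1⟩ := transport u hb (adm_b1' h0 h1) (b1_deriv h0)
  have k5 : |(inner ℂ (Xu u) (SR f (b1 σ))).re| ≤ 1 / 2 * (X * Y + Y ^ 2) := by
    change |(inner ℂ (Xu u) (Sm (𝓕 u) fun z => (b1 σ z : ℂ))).re| ≤ _
    rw [t1, abs_mul, abs_of_pos (by norm_num : (0 : ℝ) < 1 / 2)]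
    gcongr
    have j1 := (inner_SR (f := f) (adm_sQ h0) (adm_sQ h0)).1
    have j2 := (inner_SR (f := f) hS hS).1
    calc _ ≤ ∫ z, ((sQ σ z * sQ σ z * ‖f z‖ ^ 2) + s2 σ z * s2 σ z * ‖f z‖ ^ 2) := by
          rw [← Real.norm_eq_abs]
          refine norm_integral_le_of_norm_le (j1.add j2) (Filter.Eventually.of_forall fun z => ?_)
          rw [norm_mul, Real.norm_eq_abs]
          change _ * ‖‖f z‖ ^ 2‖ ≤ _
          rw [Real.norm_of_nonneg (by positivity : 0 ≤ ‖f z‖ ^ 2),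
            ← add_mul, sQ_sq h0, ← add_mul]
          gcongr
          exact b1_main h0 h1 z
      _ = ‖SR f (sQ σ)‖ ^ 2 + Y ^ 2 := by
          rw [integral_add j1 j2, hY, norm_SR_sq (adm_sQ h0), norm_SR_sq hS]
      _ ≤ _ := by
          gcongr
          exact est_Q h0 f
  refine alg1 ha0 (by linarith) X0 (by linarith) ?_
  have k6 : D * ‖SR f (b1 σ)‖ ≤ D * (X + Y) := by gcongr
  rw [abs_le] at k2 k4 k5
  have : 0 ≤ K * X * D := by positivity
  have : 0 ≤ K * (D + Y) ^ 2 := by positivity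
  nlinarith [mul_nonneg X0 Y0, mul_nonneg hD Y0, mul_nonneg X0 hD]

end Est

section Est2

lemma est0 {σ : ℝ} (h0 : 0 < σ) (u : 𝓢(Z n, ℂ)) :
    (inner ℂ (Xu u) (SR (𝓕 u) (s2 σ))).re = 0 := by
  obtain ⟨_, t⟩ := transport u (b := s2 σ) (b' := fun _ _ => 0) (adm_s2 h0)
    (fun i => AdmR.const 0) (fun i z => by
      unfold HasLineDerivAt s2
      simp only [ss_add_eV]
      exact hasDerivAt_const _ _)
  change (inner ℂ (Xu u) (Sm (𝓕 u) fun z => (s2 σ z : ℂ))).re = 0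
  rw [t]; simp

lemma est_comm [Nontrivial (E n)] {σ : ℝ} (h0 : 0 < σ) {a : Z n → ℝ} (ha : BM a) {K L : ℝ}
    (hK : ∀ z, |a z| ≤ K) (hK0 : 0 ≤ K)
    (hL : ∀ (h : E n) z, |a (z + ιx h) - a z| ≤ L * min 1 ‖h‖) :
    ∃ C : ℝ, 0 ≤ C ∧ ∀ (f : 𝓢(Z n, ℂ)) (G : Z n → ℝ), AdmR G → (∀ z, |G z| ≤ 2) →
      ‖inner ℂ (Mu a (SR f (sA σ))) (SR f (fun z => s2 σ z * G z)) -
        conj (inner ℂ (Mu a (SR f (fun z => s1 σ z * G z)))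
          (SR f (fun z => ‖vC z‖ ^ (2 * σ) * s1 σ z)))‖ ≤ C * ‖SR f (sA σ)‖ * ‖SR f (s1 σ)‖ := by
  set θ := σ / (2 * σ + 1) with hθ
  have hθ0 : 0 < θ := by positivity
  have hθ1 : θ < 1 := by rw [hθ, div_lt_one (by positivity)]; linarith
  obtain ⟨C, hC, H⟩ := commutR ιx xC inner_ιx measurable_xC hθ0 hθ1 ha hL
  refine ⟨2 * C + 4 * K, by positivity, fun f G hG hG2 => ?_⟩
  have hA := adm_sA (n := n) h0
  have hS1 := adm_s1 (n := n) h0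
  have hx : AdmR (fun z : Z n => ‖xC z‖ ^ θ) := adm_x hθ0.le
  have hr : AdmR (fun z : Z n => s1 σ z - ‖xC z‖ ^ θ) := hS1.sub hx
  have hrb : ∀ z : Z n, |s1 σ z - ‖xC z‖ ^ θ| ≤ 1 := by
    intro z
    unfold s1
    rw [ss_sig h0]
    exact scal_S1 hθ0 (norm_nonneg _)
  have hm' : AdmR (fun z => s1 σ z * G z) := hS1.mul hG
  have n1 : ‖SR f (fun z => s1 σ z * G z)‖ ≤ 2 * ‖SR f (s1 σ)‖ :=
    norm_SR_le hm' hS1 (by norm_num) fun z => by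
      rw [abs_mul, mul_comm]; gcongr; exact hG2 z
  have n2 : ‖SR f (fun z => (s1 σ z - ‖xC z‖ ^ θ) * (s1 σ z * G z))‖ ≤ 2 * ‖SR f (s1 σ)‖ := by
    refine norm_SR_le (hr.mul hm') hS1 (by norm_num) fun z => ?_
    rw [abs_mul, abs_mul]
    calc _ ≤ 1 * (|s1 σ z| * 2) := by gcongr; exacts [hrb z, hG2 z]
      _ = _ := by ring
  have n3 : ‖SR f (fun z => (s1 σ z - ‖xC z‖ ^ θ) * sA σ z)‖ ≤ 1 * ‖SR f (sA σ)‖ := by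
    refine norm_SR_le (hr.mul hA) hA (by norm_num) fun z => ?_
    rw [abs_mul]; gcongr; exact hrb z
  have e1 : SR f (fun z => s2 σ z * G z) = SR f (fun z => ‖xC z‖ ^ θ * (s1 σ z * G z)) +
      SR f (fun z => (s1 σ z - ‖xC z‖ ^ θ) * (s1 σ z * G z)) := by
    rw [← SR_add (hx.mul hm') (hr.mul hm')]
    congr 1; ext z; rw [← s1_sq h0]; ring
  have e2 : SR f (fun z => ‖vC z‖ ^ (2 * σ) * s1 σ z) = SR f (fun z => ‖xC z‖ ^ θ * sA σ z) +
      SR f (fun z => (s1 σ z - ‖xC z‖ ^ θ) * sA σ z) := by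
    rw [← SR_add (hx.mul hA) (hr.mul hA)]
    congr 1; ext z; unfold sA; ring
  have k := H f (sA σ) (fun z => s1 σ z * G z) hA (hx.mul hA) hm' (hx.mul hm')
  have k1 := inner_Mu_le ha hK hK0 (SR f (sA σ))
    (SR f (fun z => (s1 σ z - ‖xC z‖ ^ θ) * (s1 σ z * G z)))
  have k2 := inner_Mu_le ha hK hK0 (SR f (fun z => s1 σ z * G z))
    (SR f (fun z => (s1 σ z - ‖xC z‖ ^ θ) * sA σ z))
  rw [← Complex.norm_conj] at k2
  rw [e1, e2, inner_add_right, inner_add_right, map_add]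
  set X := ‖SR f (sA σ)‖
  set R := ‖SR f (s1 σ)‖
  have X0 : 0 ≤ X := norm_nonneg _
  have R0 : 0 ≤ R := norm_nonneg _
  have k' := k.trans (show _ ≤ C * X * (2 * R) by gcongr)
  have k1' := k1.trans (show _ ≤ K * X * (2 * R) by gcongr)
  have k2' := k2.trans (show _ ≤ K * (2 * R) * (1 * X) by gcongr)
  rw [add_sub_add_comm]
  refine (norm_add_le _ _).trans ?_
  refine (add_le_add k' ((norm_sub_le _ _).trans (add_le_add k1' k2'))).trans (le_of_eq ?_)
  ring

lemma int_help {α : Type*} [MeasurableSpace α] {μ : Measure α} {g0 g1 g2 g3 : α → ℝ} {c : ℝ}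
    (i0 : Integrable g0 μ) (i1 : Integrable g1 μ)
    (i2 : Integrable g2 μ) (i3 : Integrable g3 μ) (h : ∀ z, g0 z ≤ c * g1 z + g2 z + g3 z) :
    ∫ z, g0 z ∂μ ≤ c * ∫ z, g1 z ∂μ + ∫ z, g2 z ∂μ + ∫ z, g3 z ∂μ := by
  have i12 : Integrable (fun z => c * g1 z + g2 z) μ := (i1.const_mul c).add i2
  rw [← integral_const_mul, ← integral_add (i1.const_mul c) i2, ← integral_add i12 i3]
  exact integral_mono i0 (i12.add i3) h

lemma est2 {σ : ℝ} (h0 : 0 < σ) (u : 𝓢(Z n, ℂ)) :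
    ‖SR (𝓕 u) (s2 σ)‖ ^ 2 ≤ 4 * (inner ℂ (Xu u) (SR (𝓕 u) (b2 σ))).re + ‖SR (𝓕 u) (sQ σ)‖ ^ 2
      + ‖SR (𝓕 u) (s1 σ)‖ ^ 2 := by
  have hS1 := adm_s1 (n := n) h0
  have hS2 := adm_s2 (n := n) h0
  obtain ⟨i1, t1⟩ := transport u (adm_b2 h0) (adm_b2' h0) b2_deriv
  change _ ≤ 4 * (inner ℂ (Xu u) (Sm (𝓕 u) fun z => (b2 σ z : ℂ))).re + _ + _
  rw [t1, norm_SR_sq hS2, norm_SR_sq (adm_sQ h0), norm_SR_sq hS1, ← mul_assoc]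
  refine int_help (inner_SR hS2 hS2).1 i1 (inner_SR (adm_sQ h0) (adm_sQ h0)).1
    (inner_SR hS1 hS1).1 fun z => ?_
  set f := 𝓕 u
  have := mul_le_mul_of_nonneg_right (b2_main h0 z) (sq_nonneg ‖f z‖)
  change s2 σ z * s2 σ z * ‖f z‖ ^ 2 ≤ 4 * (1 / 2) * (_ * ‖f z‖ ^ 2)
    + sQ σ z * sQ σ z * ‖f z‖ ^ 2 + s1 σ z * s1 σ z * ‖f z‖ ^ 2
  rw [sQ_sq h0, s1_sq h0]
  refine this.trans (le_of_eq ?_)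
  unfold sA s2
  ring

lemma alg3 {a0 C1 Cc Cl Cu : ℝ} (ha0 : 0 < a0) (C10 : 0 ≤ C1) (hCc : 0 ≤ Cc) (hCl : 0 ≤ Cl)
    (hCu : 0 ≤ Cu) : ∃ C : ℝ, 0 ≤ C ∧ ∀ D X Y R Q r0 r1 r2 r3 rx : ℝ, 0 ≤ D → 0 ≤ X → 0 ≤ Y →
    0 ≤ R → R ^ 2 ≤ D * Y → X ≤ C1 * (D + Y) → a0 / 2 * Q ^ 2 - Cl * R ^ 2 ≤ r1 →
    |r0 - r1| ≤ Cc * X * R → |r0| ≤ D * Y → |r2 - r3| ≤ Cc * X * R → |r2 + rx| ≤ D * (2 * Y) →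
    |r3| ≤ Cu * (Q ^ 2 + 4 * Q ^ 2 + 4 * R ^ 2) → Y ^ 2 ≤ 4 * rx + Q ^ 2 + R ^ 2 →
    X ≤ C * D ∧ Y ≤ C * D := by
  obtain ⟨q0, hq0⟩ : ∃ q0, q0 = 2 / a0 * (1 + Cc + Cl) := ⟨_, rfl⟩
  have q00 : 0 ≤ q0 := by rw [hq0]; positivity
  obtain ⟨C3, hC3⟩ : ∃ C3, C3 = 9 + 4 * Cc + 16 * Cu + (20 * Cu + 1) * q0 := ⟨_, rfl⟩
  have C30 : 0 ≤ C3 := by rw [hC3]; positivity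
  obtain ⟨C4, hC4⟩ : ∃ C4, C4 = 2 * C3 + (2 * C3 * C1) ^ 2 + 1 := ⟨_, rfl⟩
  have C40 : 0 ≤ C4 := by rw [hC4]; positivity
  refine ⟨C1 * (1 + C4) + C4, by positivity, ?_⟩
  intro D X Y R Q s0 s1 s2 s3 rx hD X0 Y0 R0 hR' hX l c1 en0 c2 en2 up main
  have p1 : 0 ≤ D * Y := by positivity
  have p2 : 0 ≤ X * R := by positivity
  rw [abs_le] at c1 en0 c2 en2 up
  have q1 : a0 / 2 * Q ^ 2 ≤ (1 + Cc + Cl) * (D * Y + X * R) := by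
    have p3 : Cl * R ^ 2 ≤ Cl * (D * Y) := by gcongr
    have p4 : 0 ≤ Cl * (X * R) := by positivity
    have p5 : 0 ≤ Cc * (D * Y) := by positivity
    linarith [c1.1, c1.2, en0.1, en0.2]
  have q2 : Q ^ 2 ≤ q0 * (D * Y + X * R) := by
    calc Q ^ 2 = 2 / a0 * (a0 / 2 * Q ^ 2) := by field_simp
      _ ≤ 2 / a0 * ((1 + Cc + Cl) * (D * Y + X * R)) := by gcongr
      _ = _ := by rw [hq0]; ring
  have fin : Y ^ 2 ≤ C3 * (D * Y + X * R) := by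
    have p3 : Cu * R ^ 2 ≤ Cu * (D * Y) := by gcongr
    have p4 : 0 ≤ Cu * (X * R) := by positivity
    have p5 : 0 ≤ Cc * (D * Y) := by positivity
    have p6 : (20 * Cu + 1) * Q ^ 2 ≤ (20 * Cu + 1) * (q0 * (D * Y + X * R)) := by gcongr
    rw [hC3]
    linarith [c2.1, c2.2, up.1, up.2, en2.1, en2.2]
  have res := alg2 C30 C10 hD Y0 R0 hR' hX fin
  rw [← hC4] at res
  have p1 : 0 ≤ C1 * (1 + C4) * D := by positivity
  have p2 : 0 ≤ C4 * D := by positivity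
  have p3 : C1 * (D + Y) ≤ C1 * (D + C4 * D) := by gcongr
  constructor
  · calc X ≤ C1 * (D + C4 * D) := hX.trans p3
      _ ≤ _ := by linarith
  · linarith

lemma est_main [Nontrivial (E n)] {σ : ℝ} (h0 : 0 < σ) (h1 : σ < 1) {a : Z n → ℝ} (ha : BM a)
    {K L : ℝ} (hK : ∀ z, |a z| ≤ K) (hK0 : 0 ≤ K) {a0 : ℝ} (ha0 : 0 < a0) (hlow : ∀ z, a0 ≤ a z)
    (hLx : ∀ (h : E n) z, |a (z + ιx h) - a z| ≤ L * min 1 ‖h‖)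
    (hLv : ∀ (h : E n) z, |a (z + ιv h) - a z| ≤ L * min 1 ‖h‖) :
    ∃ C : ℝ, 0 ≤ C ∧ ∀ (u : 𝓢(Z n, ℂ)) (D : ℝ), ‖SR (𝓕 u) (fun _ => 1)‖ ≤ D →
    (∀ B, |(inner ℂ (Mu a (SR (𝓕 u) (sA σ))) B).re + (inner ℂ (Xu u) B).re| ≤ D * ‖B‖) →
    ‖SR (𝓕 u) (sA σ)‖ ≤ C * D ∧ ‖SR (𝓕 u) (s2 σ)‖ ≤ C * D := by
  obtain ⟨Cc, hCc, Hc⟩ := est_comm h0 ha hK hK0 hLx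
  obtain ⟨Cl, hCl, Hl⟩ := form_lowerR ιv vC inner_ιv measurable_vC (θ := 2 * σ) (by positivity)
    (by linarith) ha hLv ha0 hlow
  obtain ⟨Cu, hCu, Hu⟩ := form_upperR ιv vC inner_ιv measurable_vC (θ := 2 * σ) (by positivity)
    (by linarith) ha hLv hK
  obtain ⟨C, hC, H⟩ := alg3 (C1 := 2 * (K + 1) / a0 + 1) ha0 (by positivity) hCc hCl hCu
  refine ⟨C, hC, fun u D hN hen => ?_⟩
  have hD : 0 ≤ D := (norm_nonneg _).trans hN
  have hX := est1 h0 h1 ha hK hK0 ha0 hlow u hD hen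
  set f := 𝓕 u with hf
  have hA := adm_sA (n := n) h0
  have hS1 := adm_s1 (n := n) h0
  have hS2 := adm_s2 (n := n) h0
  have hG := adm_GG (n := n) σ
  have hv1 : AdmR (fun z : Z n => ‖vC z‖ ^ (2 * σ)) := adm_v (by positivity)
  have hv2 : AdmR (fun z : Z n => ‖vC z‖ ^ (2 * σ / 2)) := adm_v (by positivity)
  have c1 := Hc f (fun _ => 1) (AdmR.const 1) (fun z => by norm_num)
  have c2 := Hc f (GG σ) hG (GG_le σ)
  have l := Hl f (s1 σ) hS1 (hv1.mul hS1) (hv2.mul hS1)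
  have up := Hu f (s1 σ) (fun z => s1 σ z * GG σ z) hS1 (hv1.mul hS1) (hv2.mul hS1)
    (hS1.mul hG) (hv1.mul (hS1.mul hG)) (hv2.mul (hS1.mul hG))
  have n1 : ‖SR f (fun z => s1 σ z * GG σ z)‖ ≤ 2 * ‖SR f (s1 σ)‖ :=
    norm_SR_le (hS1.mul hG) hS1 (by norm_num) fun z => by
      rw [abs_mul, mul_comm]; gcongr; exact GG_le σ z
  have n2 : ‖SR f (fun z => ‖vC z‖ ^ (2 * σ / 2) * (s1 σ z * GG σ z))‖ ≤
      2 * ‖SR f (sQ σ)‖ :=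
    norm_SR_le (hv2.mul (hS1.mul hG)) (adm_sQ h0) (by norm_num) fun z => by
      unfold sQ
      rw [← mul_assoc, abs_mul, mul_comm]; gcongr; exact GG_le σ z
  have n3 : ‖SR f (b2 σ)‖ ≤ 2 * ‖SR f (s2 σ)‖ :=
    norm_SR_le (adm_b2 h0) hS2 (by norm_num) fun z => by
      unfold b2 s2
      rw [abs_mul, mul_comm]; gcongr; exact GG_le σ z
  have hR := est_R h0 f
  have hQ : ‖SR f fun z => ‖vC z‖ ^ (2 * σ / 2) * s1 σ z‖ = ‖SR f (sQ σ)‖ := rfl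
  rw [hQ] at l up
  simp only [mul_one] at c1
  have es2 : (SR f fun z => s2 σ z) = SR f (s2 σ) := rfl
  have es1 : (SR f fun z => s1 σ z) = SR f (s1 σ) := rfl
  have eb2 : (SR f fun z => s2 σ z * GG σ z) = SR f (b2 σ) := rfl
  rw [es2, es1] at c1
  rw [eb2] at c2
  have z0 := est0 h0 u
  have en0 := hen (SR f (s2 σ))
  rw [z0, add_zero] at en0
  have en2 := hen (SR f (b2 σ))
  -- the main lower bound
  have main := est2 h0 u
  rw [← hf] at main
  have hR' : ‖SR f (s1 σ)‖ ^ 2 ≤ D * ‖SR f (s2 σ)‖ := hR.trans (by gcongr)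
  have n1' : ‖SR f (fun z => s1 σ z * GG σ z)‖ ^ 2 ≤ 4 * ‖SR f (s1 σ)‖ ^ 2 := by
    calc _ ≤ (2 * ‖SR f (s1 σ)‖) ^ 2 := by gcongr
      _ = _ := by ring
  have n2' : ‖SR f (fun z => ‖vC z‖ ^ (2 * σ / 2) * (s1 σ z * GG σ z))‖ ^ 2 ≤
      4 * ‖SR f (sQ σ)‖ ^ 2 := by
    calc _ ≤ (2 * ‖SR f (sQ σ)‖) ^ 2 := by gcongr
      _ = _ := by ring
  have up' := up.trans (show _ ≤ Cu * (‖SR f (sQ σ)‖ ^ 2 + 4 * ‖SR f (sQ σ)‖ ^ 2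
    + 4 * ‖SR f (s1 σ)‖ ^ 2) by gcongr)
  rw [← Complex.norm_conj] at up'
  have w1 := (Complex.abs_re_le_norm _).trans c1
  have w2 := (Complex.abs_re_le_norm _).trans c2
  rw [Complex.sub_re] at w1 w2
  rw [Complex.conj_re] at w1
  exact H D _ _ _ _ _ _ _ _ _ hD (norm_nonneg _) (norm_nonneg _) (norm_nonneg _) hR' hX l w1 en0 w2
    (en2.trans (by gcongr)) ((Complex.abs_re_le_norm _).trans up') main

end Est2

section Final

lemma lip_of {a : Z n → ℝ} (ha : ContDiff ℝ (⊤ : ℕ∞) a) {K K' : ℝ} (hK : ∀ z, |a z| ≤ K)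
    (hK' : ∀ z, ‖fderiv ℝ a z‖ ≤ K') (h z : Z n) :
    |a (z + h) - a z| ≤ (2 * K + K') * min 1 ‖h‖ := by
  have hK0 : 0 ≤ K := (abs_nonneg _).trans (hK 0)
  have hK'0 : 0 ≤ K' := (norm_nonneg _).trans (hK' 0)
  have h1 : |a (z + h) - a z| ≤ K' * ‖h‖ := by
    have := Convex.norm_image_sub_le_of_norm_fderiv_le (𝕜 := ℝ) (f := a) (s := Set.univ) (C := K')
      (x := z) (y := z + h) (fun x _ => (ha.differentiable (by simp)).differentiableAt)
      (fun x _ => hK' x) convex_univ (Set.mem_univ _) (Set.mem_univ _)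
    simpa using this
  have h2 : |a (z + h) - a z| ≤ 2 * K := by
    have h3 := hK (z + h); have h4 := hK z
    rw [abs_le] at *; constructor <;> linarith
  rcases le_total 1 ‖h‖ with h3 | h3
  · rw [min_eq_left h3]; linarith
  · rw [min_eq_right h3]
    have : 0 ≤ K * ‖h‖ := by positivity
    linarith

lemma SR_one_ae (u : 𝓢(Z n, ℂ)) : (SR (𝓕 u) (fun _ => 1) : Z n → ℂ) =ᵐ[volume] u := by
  refine (Sm_ae (AdmR.const 1)).trans (Filter.Eventually.of_forall fun z => ?_)
  simp only [Complex.ofReal_one, one_mul]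
  change (𝓕⁻ ((𝓕 u : 𝓢(Z n, ℂ)) : Z n → ℂ)) z = u z
  rw [← SchwartzMap.fourierInv_coe, FourierTransform.fourierInv_fourier_eq]

lemma eLpNorm_HH (W : HH (Z n)) {g : Z n → ℂ} (h : (W : Z n → ℂ) =ᵐ[volume] g) :
    eLpNorm g 2 volume = ENNReal.ofReal ‖W‖ := by
  rw [← eLpNorm_congr_ae h, Lp.norm_def, ENNReal.ofReal_toReal (Lp.eLpNorm_ne_top W)]

lemma eLpNorm_mult (u : 𝓢(Z n, ℂ)) {m : Z n → ℝ} (hm : AdmR m) :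
    eLpNorm (fun z => (m z : ℂ) * FourierTransform.fourier (⇑u) z) 2 volume =
      ENNReal.ofReal ‖SR (𝓕 u) m‖ := by
  have h1 : ‖SR (𝓕 u) m‖ = ‖𝓕 (SR (𝓕 u) m)‖ := (Lp.norm_fourier_eq _).symm
  rw [h1]
  apply eLpNorm_HH
  unfold SR
  rw [fourier_Sm hm]
  exact MemLp.coeFn_toLp _

lemma Pop_ae {σ : ℝ} {w : E n → ℝ} {a : Z n → ℝ} (ha : BM a) (u : 𝓢(Z n, ℂ))
    (hF : AdmR (fun z : Z n => Fsym σ w (vC z))) :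
    ((Xu u + Mu a (SR (𝓕 u) (fun z => Fsym σ w (vC z))) : HH (Z n)) : Z n → ℂ) =ᵐ[volume]
      Pop σ w a ⇑u := by
  filter_upwards [Lp.coeFn_add (Xu u) (Mu a (SR (𝓕 u) (fun z => Fsym σ w (vC z)))),
    Mu_ae ha (SR (𝓕 u) (fun z => Fsym σ w (vC z))), Sm_ae (f := 𝓕 u) hF,
    (uX u).coeFn_toLp 2 volume] with z h1 h2 h3 h4
  rw [h1, Pi.add_apply, h2]
  unfold SR
  rw [h3]
  unfold Xu
  rw [h4, uX_apply]
  rfl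

end Final

/-- Proposition 2.1: key hypoelliptic estimate for Schwartz
functions whose support in the time variable is contained in `[-T,T]`. -/
theorem statement4
    (n : ℕ) (hn : 1 ≤ n) (σ : ℝ) (hσ0 : 0 < σ) (hσ1 : σ < 1)
    (w : E n → ℝ) (hw : ContDiff ℝ (⊤ : ℕ∞) w)
    (hw01 : ∀ η, 0 ≤ w η ∧ w η ≤ 1)
    (hwout : ∀ η : E n, 2 ≤ ‖η‖ → w η = 1)
    (hwin : ∀ η : E n, ‖η‖ ≤ 1 → w η = 0)
    (a : Z n → ℝ) (ha : ContDiff ℝ (⊤ : ℕ∞) a)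
    (haB : ∀ k : ℕ, ∃ C : ℝ, ∀ z, ‖iteratedFDeriv ℝ k a z‖ ≤ C)
    (a₀ : ℝ) (ha₀ : 0 < a₀) (haLB : ∀ z, a₀ ≤ a z)
    (T : ℝ) (hT : 0 < T) :
    ∃ C : ℝ, 0 < C ∧ ∀ u : SchwartzMap (Z n) ℂ,
      (∀ z : Z n, u z ≠ 0 → tC z ∈ Set.Icc (-T) T) →
      eLpNorm (fun ζ => (((1 + ‖xC ζ‖ ^ (2 * σ / (2 * σ + 1)) + ‖vC ζ‖ ^ (2 * σ)) : ℝ) : ℂ)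
          * FourierTransform.fourier (⇑u) ζ) 2 volume
        ≤ ENNReal.ofReal C *
          (eLpNorm (Pop σ w a ⇑u) 2 volume + eLpNorm (⇑u) 2 volume) := by
  have : NeZero n := ⟨by omega⟩
  have : Nontrivial (E n) := inferInstance
  obtain ⟨K, hK⟩ := haB 0
  obtain ⟨K', hK'⟩ := haB 1
  simp only [norm_iteratedFDeriv_zero, Real.norm_eq_abs] at hK
  simp only [norm_iteratedFDeriv_one] at hK'
  have hK0 : 0 ≤ K := (abs_nonneg _).trans (hK 0)
  have hBM : BM a := ⟨ha.continuous.measurable, K, hK⟩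
  have hLx : ∀ (h : E n) z, |a (z + ιx h) - a z| ≤ (2 * K + K') * min 1 ‖h‖ := by
    intro h z; rw [← norm_ιx]; exact lip_of ha hK hK' _ _
  have hLv : ∀ (h : E n) z, |a (z + ιv h) - a z| ≤ (2 * K + K') * min 1 ‖h‖ := by
    intro h z; rw [← norm_ιv]; exact lip_of ha hK hK' _ _
  obtain ⟨C, hC, H⟩ := est_main hσ0 hσ1 hBM hK hK0 ha₀ haLB hLx hLv
  -- the symbol F
  have hA := adm_sA (n := n) hσ0
  have hwm : Measurable w := hw.continuous.measurable
  have hrb : ∀ z : Z n, |Fsym σ w (vC z) - sA σ z| ≤ 4 := fun z =>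
    scal_F hσ0 hσ1 (norm_nonneg _) (hw01 _).1 (hw01 _).2 (hwout _)
  have hFm : Measurable (fun z : Z n => Fsym σ w (vC z)) := by
    have := measurable_vC (n := n)
    have h2 : Measurable (fun z : Z n => w (vC z)) := hwm.comp this
    unfold Fsym; fun_prop
  have hAm : Measurable (sA σ : Z n → ℝ) := by
    have := measurable_vC (n := n)
    unfold sA; fun_prop
  have hr : AdmR (fun z : Z n => Fsym σ w (vC z) - sA σ z) :=
    AdmR.of_bdd (hFm.sub hAm) 4 hrb
  have hF : AdmR (fun z : Z n => Fsym σ w (vC z)) := by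
    have := hA.add hr
    simpa using this
  have h2σ : 0 ≤ 2 * σ / (2 * σ + 1) := by positivity
  refine ⟨1 + 2 * C * (1 + (4 * K + 1)) + (4 * K + 1), by positivity, fun u _ => ?_⟩
  set f := 𝓕 u with hf
  set W := Xu u + Mu a (SR f (fun z => Fsym σ w (vC z))) with hW
  have hN : ‖SR f (fun _ => 1)‖ = ‖SR f (fun _ => 1)‖ := rfl
  have eW : W = Xu u + Mu a (SR f (sA σ)) + Mu a (SR f (fun z => Fsym σ w (vC z) - sA σ z)) := by
    rw [hW, add_assoc, ← Mu_add hBM, ← SR_add hA hr]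
    simp
  have hV : ‖SR f (fun z => Fsym σ w (vC z) - sA σ z)‖ ≤ 4 * ‖SR f (fun _ => 1)‖ :=
    norm_SR_le hr (AdmR.const 1) (by norm_num) fun z => by simpa using hrb z
  set N := ‖SR f (fun _ => 1)‖ with hNdef
  have N0 : 0 ≤ N := norm_nonneg _
  have W0 : 0 ≤ ‖W‖ := norm_nonneg _
  have KN : 0 ≤ K * N := by positivity
  obtain ⟨r1, r2⟩ := H u (‖W‖ + 4 * K * N + N) (by linarith)
    (fun B => en_gen hBM hK eW hV hK0 N0)
  have hx : AdmR (fun z : Z n => ‖xC z‖ ^ (2 * σ / (2 * σ + 1))) := adm_x h2σ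
  have r3 : ‖SR f (fun z => ‖xC z‖ ^ (2 * σ / (2 * σ + 1)))‖ ≤ 1 * ‖SR f (s2 σ)‖ := by
    refine norm_SR_le hx (adm_s2 hσ0) (by norm_num) fun z => ?_
    rw [one_mul, abs_of_nonneg (s2_nonneg hσ0 z), abs_of_nonneg (by positivity)]
    unfold s2 ss
    rw [← Real.rpow_mul (by linarith [one_le_MX z])]
    have : 1 / (2 * σ + 1) * (2 * σ) = 2 * σ / (2 * σ + 1) := by ring
    rw [this]
    exact Real.rpow_le_rpow (norm_nonneg _) (le_max_right _ _) h2σ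
  refine (le_of_eq (eLpNorm_mult u (((AdmR.const 1).add hx).add hA))).trans ?_
  rw [eLpNorm_HH W (Pop_ae hBM u hF),
    eLpNorm_HH _ (SR_one_ae u), ← ENNReal.ofReal_add W0 (norm_nonneg _),
    ← ENNReal.ofReal_mul (by positivity)]
  apply ENNReal.ofReal_le_ofReal
  rw [SR_add ((AdmR.const 1).add hx) hA, SR_add (AdmR.const 1) hx]
  have t := norm_add₃_le (a := SR f (fun _ => 1))
    (b := SR f (fun z => ‖xC z‖ ^ (2 * σ / (2 * σ + 1)))) (c := SR f (sA σ))
  refine t.trans ?_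
  change N + _ + _ ≤ _ * (‖W‖ + N)
  have p1 : ‖W‖ + 4 * K * N + N ≤ (1 + (4 * K + 1)) * (‖W‖ + N) := by
    have : 0 ≤ K * ‖W‖ := by positivity
    linarith
  have p2 := mul_le_mul_of_nonneg_left p1 hC
  have p3 : 0 ≤ K * (‖W‖ + N) := by positivity
  change ‖SR f (sA σ)‖ ≤ _ at r1
  change ‖SR f (s2 σ)‖ ≤ _ at r2
  linarith
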